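/- arXiv:math/9809125 — 12 statements merged into one kernel-verified Lean document; each statement's English description precedes it below -/
import Mathlib

section
/- For every natural number m < 105, every coefficient of the m-th cyclotomic polynomial over ℤ lies in {-1, 0, 1}, while the 105-th cyclotomic polynomial over ℤ has at least one coefficient not in {-1, 0, 1} (indeed its coefficient of X^7 is -2). Consequently 105 is the smallest n for which the irreducible rational factorization of 1 - x^n contains a coefficient different from 0 and ±1. -/
namespace CyclotomicList

open Polynomial

/-- The integer polynomial with the given list of coefficients, constant term first. -/
noncomputable def toPoly : List ℤ → ℤ[X]
  | [] => 0
  | a :: l => C a + X * toPoly l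

theorem coeff_toPoly (l : List ℤ) (i : ℕ) : (toPoly l).coeff i = l.getD i 0 := by
  induction l generalizing i with
  | nil => simp [toPoly]
  | cons a l ih => cases i <;> simp [toPoly, coeff_C_succ, ih, -eq_intCast]

theorem toPoly_eq_head_add_tail (l : List ℤ) :
    toPoly l = C (l.headD 0) + X * toPoly l.tail := by
  cases l <;> simp [toPoly]

theorem toPoly_eq_zero {l : List ℤ} (h : ∀ a ∈ l, a = 0) : toPoly l = 0 := by
  induction l with
  | nil => rfl
  | cons a l ih => simp_all [toPoly]

theorem toPoly_replicate_zero_append (k : ℕ) (l : List ℤ) :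
    toPoly (List.replicate k 0 ++ l) = X ^ k * toPoly l := by
  induction k with
  | zero => simp
  | succ k ih => simp [List.replicate_succ, toPoly, ih, pow_succ', mul_assoc]

/-- Coefficients of `f(X ^ (k + 1))`, up to trailing zeros. -/
def expandSucc (k : ℕ) : List ℤ → List ℤ
  | [] => []
  | a :: l => a :: (List.replicate k 0 ++ expandSucc k l)

theorem toPoly_expandSucc (k : ℕ) (l : List ℤ) :
    toPoly (expandSucc k l) = expand ℤ (k + 1) (toPoly l) := by
  induction l with
  | nil => simp [expandSucc, toPoly]
  | cons a l ih =>
    simp [expandSucc, toPoly, toPoly_replicate_zero_append, ih, pow_succ', mul_assoc]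

/-- Coefficients of `f - a * g`. -/
def subMul (a : ℤ) : List ℤ → List ℤ → List ℤ
  | [], g => g.map (-a * ·)
  | f, [] => f
  | x :: f, y :: g => (x - a * y) :: subMul a f g

theorem toPoly_map_mul (a : ℤ) (l : List ℤ) :
    toPoly (l.map (a * ·)) = C a * toPoly l := by
  induction l with
  | nil => simp [toPoly]
  | cons b l ih =>
    simp only [List.map_cons, toPoly, ih, C_mul]
    ring

theorem toPoly_subMul (a : ℤ) (f g : List ℤ) :
    toPoly (subMul a f g) = toPoly f - C a * toPoly g := by
  fun_induction subMul a f g with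
  | case1 g => rw [toPoly_map_mul, toPoly, C_neg, zero_sub, neg_mul]
  | case2 f => simp [toPoly]
  | case3 x f y g ih =>
    simp only [toPoly, ih, C_sub, C_mul]
    ring

/-- Exact division of `f` by `c + X * g`, where `c = ±1`, with a quotient of length `k`. -/
def exactDiv (c : ℤ) (g : List ℤ) : ℕ → List ℤ → Option (List ℤ)
  | 0, f => if ∀ a ∈ f, a = 0 then some [] else none
  | k + 1, f =>
    if f.headD 0 = f.headD 0 * c * c then
      (exactDiv c g k (subMul (f.headD 0 * c) f.tail g)).map (f.headD 0 * c :: ·)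
    else none

theorem toPoly_exactDiv {c : ℤ} {g : List ℤ} {k : ℕ} {f q : List ℤ}
    (h : exactDiv c g k f = some q) :
    toPoly f = toPoly q * (C c + X * toPoly g) := by
  induction k generalizing f q with
  | zero =>
    simp only [exactDiv, Option.ite_none_right_eq_some, Option.some.injEq] at h
    obtain ⟨h0, rfl⟩ := h
    simp [toPoly_eq_zero h0, toPoly]
  | succ k ih =>
    simp only [exactDiv, Option.ite_none_right_eq_some, Option.map_eq_some_iff] at h
    obtain ⟨hc, q', hq, rfl⟩ := h
    have hrec := ih hq
    rw [toPoly_subMul] at hrec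
    have hhead : (C (f.headD 0) : ℤ[X]) = C (f.headD 0 * c) * C c := by
      rw [← C_mul, ← hc]
    rw [toPoly_eq_head_add_tail f, toPoly, hhead]
    linear_combination X * hrec

/-- The least divisor of `n` that is at least `2`, if there is one. -/
def leastFactor (n : ℕ) : Option ℕ :=
  (List.range (n + 1)).find? fun p => 2 ≤ p ∧ p ∣ n

theorem leastFactor_spec {n p : ℕ} (h : leastFactor n = some p) : p.Prime ∧ p ∣ n := by
  simp only [leastFactor, List.find?_range_eq_some] at h
  obtain ⟨hp, -, hmin⟩ := h
  obtain ⟨h2, hpn⟩ := of_decide_eq_true hp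
  refine ⟨Nat.prime_def_minFac.2 ⟨h2, ?_⟩, hpn⟩
  refine (Nat.minFac_le (by omega)).antisymm (not_lt.1 fun hlt => ?_)
  have hfac := hmin _ hlt
  simp only [Bool.not_eq_true', decide_eq_false_iff_not] at hfac
  exact hfac ⟨(Nat.minFac_prime (by omega)).two_le, (Nat.minFac_dvd p).trans hpn⟩

/-- Coefficients of the `n`-th cyclotomic polynomial, computed by removing one prime factor of `n`
at a time; the first argument bounds the number of steps. -/
def cyclotomicCoeffs : ℕ → ℕ → Option (List ℤ)
  | 0, _ => none
  | k + 1, n =>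
    if n = 0 then some [1]
    else if n = 1 then some [-1, 1]
    else (leastFactor n).bind fun p => (cyclotomicCoeffs k (n / p)).bind fun l =>
      if p ∣ n / p then some (expandSucc (p - 1) l)
      else exactDiv (l.headD 0) l.tail ((l.length - 1) * (p - 1) + 1) (expandSucc (p - 1) l)

theorem toPoly_cyclotomicCoeffs {k n : ℕ} {l : List ℤ} (h : cyclotomicCoeffs k n = some l) :
    toPoly l = cyclotomic n ℤ := by
  induction k generalizing n l with
  | zero => simp [cyclotomicCoeffs] at h
  | succ k ih =>
    rw [cyclotomicCoeffs] at h
    split_ifs at h with h0 h1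
    · obtain rfl := Option.some.inj h
      simp [h0, toPoly]
    · obtain rfl := Option.some.inj h
      simp [h1, toPoly]
      ring
    · simp only [Option.bind_eq_some_iff] at h
      obtain ⟨p, hp, l', hl', h⟩ := h
      obtain ⟨hprime, hpn⟩ := leastFactor_spec hp
      have hexp : toPoly (expandSucc (p - 1) l') = expand ℤ p (cyclotomic (n / p) ℤ) := by
        rw [toPoly_expandSucc, Nat.sub_add_cancel hprime.one_le, ih hl']
      have hn : n / p * p = n := Nat.div_mul_cancel hpn
      split_ifs at h with hdvd
      · obtain rfl := Option.some.inj h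
        rw [hexp, cyclotomic_expand_eq_cyclotomic hprime hdvd, hn]
      · have hdiv := toPoly_exactDiv h
        rw [hexp, cyclotomic_expand_eq_cyclotomic_mul hprime hdvd, hn,
          ← toPoly_eq_head_add_tail, ih hl'] at hdiv
        exact (mul_right_cancel₀ (cyclotomic_ne_zero _ ℤ) hdiv).symm

theorem exists_flat_cyclotomicCoeffs :
    ∀ n < 105, ∃ l ∈ cyclotomicCoeffs 8 n, ∀ a ∈ l, a = -1 ∨ a = 0 ∨ a = 1 := by
  decide +kernel

theorem cyclotomicCoeffs_105 :
    ∃ l ∈ cyclotomicCoeffs 8 105, l.getD 7 0 = -2 := by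
  decide +kernel

end CyclotomicList

/-- For every `m < 105`, every coefficient of the `m`-th cyclotomic polynomial over `ℤ`
lies in `{-1, 0, 1}`, while the 105-th cyclotomic polynomial has a coefficient outside
this set; indeed its coefficient of `X^7` is `-2`. -/
theorem cyclotomic_coeffs_105 :
    (∀ m : ℕ, m < 105 → ∀ i : ℕ,
      (Polynomial.cyclotomic m ℤ).coeff i ∈ ({-1, 0, 1} : Set ℤ)) ∧
    (∃ i : ℕ, (Polynomial.cyclotomic 105 ℤ).coeff i ∉ ({-1, 0, 1} : Set ℤ)) ∧
    (Polynomial.cyclotomic 105 ℤ).coeff 7 = -2 := by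
  have h7 : (Polynomial.cyclotomic 105 ℤ).coeff 7 = -2 := by
    obtain ⟨l, hl, h⟩ := CyclotomicList.cyclotomicCoeffs_105
    rw [← CyclotomicList.toPoly_cyclotomicCoeffs hl, CyclotomicList.coeff_toPoly, h]
  refine ⟨fun m hm i => ?_, ⟨7, by simp [h7]⟩, h7⟩
  obtain ⟨l, hl, h⟩ := CyclotomicList.exists_flat_cyclotomicCoeffs m hm
  rw [← CyclotomicList.toPoly_cyclotomicCoeffs hl, CyclotomicList.coeff_toPoly]
  by_cases hi : i < l.length
  · rw [List.getD_eq_getElem _ _ hi]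
    exact h _ (List.getElem_mem hi)
  · rw [List.getD_eq_default _ _ (not_lt.1 hi)]
    simp
end

section
/- The infinite series ∑_{k=1}^∞ (-1)^{k+1} (4k+1)(2k)! / (k! · 4^k · (2k-1) · (k+1)!) converges and its sum equals 1. -/
open Nat

/-- The `k`-th Catalan number divided by `4 ^ k`. -/
noncomputable def scaledCatalan (k : ℕ) : ℝ := (2 * k)! / (k ! * 4 ^ k * (k + 1)!)

lemma scaledCatalan_zero : scaledCatalan 0 = 1 := by simp [scaledCatalan]

lemma scaledCatalan_nonneg (k : ℕ) : 0 ≤ scaledCatalan k := by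
  unfold scaledCatalan
  positivity

lemma cast_factorial_two_mul_succ (k : ℕ) :
    ((2 * (k + 1))! : ℝ) = (2 * k + 2) * (2 * k + 1) * (2 * k)! := by
  rw [show 2 * (k + 1) = 2 * k + 1 + 1 by ring, factorial_succ, factorial_succ]
  push_cast
  ring

lemma scaledCatalan_eq_sub (k : ℕ) :
    scaledCatalan k = 2 * ((2 * k)! / (k ! ^ 2 * 4 ^ k) : ℝ) -
      2 * ((2 * (k + 1))! / ((k + 1)! ^ 2 * 4 ^ (k + 1))) := by
  rw [scaledCatalan, cast_factorial_two_mul_succ, factorial_succ]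
  push_cast
  field_simp
  ring

lemma summable_scaledCatalan : Summable scaledCatalan := by
  refine summable_of_sum_range_le (c := 2) scaledCatalan_nonneg fun n => ?_
  simp_rw [scaledCatalan_eq_sub]
  rw [Finset.sum_range_sub' fun k : ℕ => 2 * ((2 * k)! / (k ! ^ 2 * 4 ^ k) : ℝ)]
  have : (0 : ℝ) ≤ 2 * ((2 * n)! / (n ! ^ 2 * 4 ^ n)) := by positivity
  simpa using this

/-- SIAM Review 36 (1994), Problem 94-2:
`∑_{k=1}^∞ (-1)^{k+1} (4k+1)(2k)! / (k! · 4^k · (2k-1) · (k+1)!) = 1`. -/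
theorem siam_94_2 :
    HasSum (fun m : ℕ =>
      ((-1 : ℝ)) ^ ((m + 1) + 1) * (4 * (m + 1) + 1) * (2 * (m + 1))! /
        (((m + 1)! : ℝ) * 4 ^ (m + 1) * (2 * ((m : ℝ) + 1) - 1) * ((m + 1) + 1)!))
      1 := by
  have hs : Summable fun m : ℕ => (-1 : ℝ) ^ m * scaledCatalan m :=
    .of_norm (by simpa [abs_of_nonneg (scaledCatalan_nonneg _)] using summable_scaledCatalan)
  have hd := hs.hasSum.sub ((hasSum_nat_add_iff' 1).mpr hs.hasSum)
  simp only [Finset.range_one, Finset.sum_singleton, pow_zero, one_mul, scaledCatalan_zero,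
    sub_sub_cancel] at hd
  refine hd.congr_fun fun m => ?_
  rw [show 2 * ((m : ℝ) + 1) - 1 = 2 * m + 1 by ring]
  simp only [scaledCatalan, cast_factorial_two_mul_succ, factorial_succ]
  push_cast
  field_simp
  ring
end

section
/- Define the Apéry numbers A(n) = ∑_{k=0}^{n} C(n,k)² · C(n+k,k)² for natural numbers n. Then for every natural number n, (n+2)³ · A(n+2) - (2n+3)(17n² + 51n + 39) · A(n+1) + (n+1)³ · A(n) = 0. -/
/-- The Apéry numbers `A(n) = ∑_{k=0}^{n} C(n,k)²·C(n+k,k)²`. -/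
def aperyNumber (n : ℕ) : ℤ :=
  ∑ k ∈ Finset.range (n + 1), ((n.choose k : ℤ)) ^ 2 * (((n + k).choose k : ℤ)) ^ 2

/-- The product `C(n,k)·C(n+k,k)`, whose square is the summand of `aperyNumber n`. -/
def aperyTerm (n k : ℕ) : ℤ := (n.choose k : ℤ) * ((n + k).choose k : ℤ)

theorem aperyTerm_eq_zero {n k : ℕ} (h : n < k) : aperyTerm n k = 0 := by
  simp [aperyTerm, Nat.choose_eq_zero_of_lt h]

@[simp]
theorem aperyTerm_zero_right (n : ℕ) : aperyTerm n 0 = 1 := by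
  simp [aperyTerm]

theorem aperyNumber_eq_sum_range {n N : ℕ} (h : n < N) :
    aperyNumber n = ∑ k ∈ Finset.range N, aperyTerm n k ^ 2 := by
  have hsub : Finset.range (n + 1) ⊆ Finset.range N := Finset.range_subset_range.2 h
  rw [← Finset.sum_subset hsub]
  · simp only [aperyNumber, aperyTerm, mul_pow]
  · intro k _ hk
    rw [aperyTerm_eq_zero (by simpa using hk), zero_pow two_ne_zero]

theorem succ_mul_choose_succ_right (n k : ℕ) :
    ((k : ℤ) + 1) * (n.choose (k + 1) : ℤ) = ((n : ℤ) - k) * (n.choose k : ℤ) := by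
  rcases le_or_gt k n with h | h
  · have := congrArg (Nat.cast : ℕ → ℤ) (Nat.choose_succ_right_eq n k)
    push_cast [h] at this
    linear_combination this
  · simp [Nat.choose_eq_zero_of_lt h, Nat.choose_eq_zero_of_lt (h.trans k.lt_succ_self)]

theorem succ_mul_choose_succ_succ (n k : ℕ) :
    ((k : ℤ) + 1) * ((n + 1).choose (k + 1) : ℤ) = ((n : ℤ) + 1) * (n.choose k : ℤ) := by
  have := congrArg (Nat.cast : ℕ → ℤ) (Nat.add_one_mul_choose_eq n k)
  push_cast at this
  linear_combination -this

theorem sub_mul_choose_succ_left (n k : ℕ) :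
    ((n : ℤ) + 1 - k) * ((n + 1).choose k : ℤ) = ((n : ℤ) + 1) * (n.choose k : ℤ) := by
  have h₁ := succ_mul_choose_succ_succ n k
  have h₂ := succ_mul_choose_succ_right (n + 1) k
  push_cast at h₂
  linear_combination h₁ - h₂

theorem sq_mul_aperyTerm_succ_right (n k : ℕ) :
    ((k : ℤ) + 1) ^ 2 * aperyTerm n (k + 1) =
      ((n : ℤ) - k) * ((n : ℤ) + k + 1) * aperyTerm n k := by
  have h₁ := succ_mul_choose_succ_right n k
  have h₂ := succ_mul_choose_succ_succ (n + k) k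
  push_cast at h₂
  simp only [aperyTerm, ← add_assoc]
  linear_combination ((k : ℤ) + 1) * ((n + k + 1).choose (k + 1) : ℤ) * h₁ +
    ((n : ℤ) - k) * (n.choose k : ℤ) * h₂

theorem sub_mul_aperyTerm_succ_left (n k : ℕ) :
    ((n : ℤ) + 1 - k) * aperyTerm (n + 1) k = ((n : ℤ) + 1 + k) * aperyTerm n k := by
  have h₁ := sub_mul_choose_succ_left n k
  have h₂ := sub_mul_choose_succ_left (n + k) k
  push_cast at h₂
  simp only [aperyTerm, add_right_comm n 1 k]
  linear_combination ((n + k + 1).choose k : ℤ) * h₁ + (n.choose k : ℤ) * h₂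

theorem sq_mul_aperyTerm_succ_succ (n k : ℕ) :
    ((k : ℤ) + 1) ^ 2 * aperyTerm (n + 1) (k + 1) =
      ((n : ℤ) + k + 1) * ((n : ℤ) + k + 2) * aperyTerm n k := by
  have h₁ := succ_mul_choose_succ_succ n k
  have h₂ := succ_mul_choose_succ_succ (n + k + 1) k
  have h₃ := sub_mul_choose_succ_left (n + k) k
  push_cast at h₂ h₃
  have e : n + 1 + (k + 1) = n + k + 1 + 1 := by ring
  simp only [aperyTerm, e]
  linear_combination ((k : ℤ) + 1) * ((n + k + 1 + 1).choose (k + 1) : ℤ) * h₁ +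
    ((n : ℤ) + 1) * (n.choose k : ℤ) * h₂ + ((n : ℤ) + k + 2) * (n.choose k : ℤ) * h₃

/-- Zeilberger's certificate for the Apéry recurrence. -/
def aperyCertificate (n k : ℕ) : ℤ :=
  4 * (2 * (n : ℤ) + 3) * ((k : ℤ) * (2 * k + 1) - (2 * (n : ℤ) + 3) ^ 2) *
    aperyTerm (n + 1) k ^ 2

/-- The Apéry recurrence operator applied to the summand `aperyTerm n k ^ 2`. -/
def aperySummand (n k : ℕ) : ℤ :=
  ((n : ℤ) + 2) ^ 3 * aperyTerm (n + 2) k ^ 2 -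
    (2 * (n : ℤ) + 3) * (17 * (n : ℤ) ^ 2 + 51 * (n : ℤ) + 39) * aperyTerm (n + 1) k ^ 2 +
    ((n : ℤ) + 1) ^ 3 * aperyTerm n k ^ 2

theorem aperySummand_succ (n k : ℕ) :
    aperySummand n (k + 1) = aperyCertificate n (k + 1) - aperyCertificate n k := by
  have h₀ : ((k : ℤ) + 1) ^ 2 * aperyTerm n (k + 1) =
      ((n : ℤ) + 1 - k) * ((n : ℤ) - k) * aperyTerm (n + 1) k := by
    linear_combination sq_mul_aperyTerm_succ_right n k -
      ((n : ℤ) - k) * sub_mul_aperyTerm_succ_left n k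
  have h₁ := sq_mul_aperyTerm_succ_right (n + 1) k
  have h₂ := sq_mul_aperyTerm_succ_succ (n + 1) k
  replace h₀ := congrArg (· ^ 2) h₀
  replace h₁ := congrArg (· ^ 2) h₁
  replace h₂ := congrArg (· ^ 2) h₂
  push_cast at h₀ h₁ h₂
  have hk : ((k : ℤ) + 1) ^ 4 ≠ 0 := by positivity
  apply mul_left_cancel₀ hk
  simp only [aperySummand, aperyCertificate]
  push_cast
  linear_combination ((n : ℤ) + 2) ^ 3 * h₂ -
    ((2 * (n : ℤ) + 3) * (17 * (n : ℤ) ^ 2 + 51 * (n : ℤ) + 39) +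
      4 * (2 * (n : ℤ) + 3) *
        (((k : ℤ) + 1) * (2 * ((k : ℤ) + 1) + 1) - (2 * (n : ℤ) + 3) ^ 2)) * h₁ +
    ((n : ℤ) + 1) ^ 3 * h₀

theorem sum_range_succ_aperySummand (n m : ℕ) :
    ∑ k ∈ Finset.range (m + 1), aperySummand n k = aperyCertificate n m := by
  induction m with
  | zero =>
    simp [aperySummand, aperyCertificate]
    ring
  | succ m ih => rw [Finset.sum_range_succ, ih, aperySummand_succ, add_sub_cancel]

/-- The Apéry numbers satisfy the recurrence
`(n+2)³A(n+2) - (2n+3)(17n²+51n+39)A(n+1) + (n+1)³A(n) = 0`. -/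
theorem apery_recurrence (n : ℕ) :
    ((n : ℤ) + 2) ^ 3 * aperyNumber (n + 2) -
      (2 * (n : ℤ) + 3) * (17 * (n : ℤ) ^ 2 + 51 * (n : ℤ) + 39) * aperyNumber (n + 1) +
      ((n : ℤ) + 1) ^ 3 * aperyNumber n = 0 := by
  have h := sum_range_succ_aperySummand n (n + 2)
  simp only [aperySummand, Finset.sum_add_distrib, Finset.sum_sub_distrib,
    ← Finset.mul_sum] at h
  rw [aperyNumber_eq_sum_range (show n + 2 < n + 2 + 1 by lia),
    aperyNumber_eq_sum_range (show n + 1 < n + 2 + 1 by lia),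
    aperyNumber_eq_sum_range (show n < n + 2 + 1 by lia), h, aperyCertificate,
    aperyTerm_eq_zero (by lia)]
  ring
end

section
/- For every natural number n, ∑_{k=0}^{n} (-1)^k · C(n,k) · C(3k,n) = (-3)^n, as an identity of integers. -/
open Polynomial in
/-- `∑_{k=0}^{n} (-1)^k·C(n,k)·C(3k,n) = (-3)^n`. -/
theorem sum_neg_three_pow (n : ℕ) :
    ∑ k ∈ Finset.range (n + 1),
      (-1 : ℤ) ^ k * (n.choose k : ℤ) * ((3 * k).choose n : ℤ) = (-3 : ℤ) ^ n := by
  have expand : (-(1 + X : ℤ[X]) ^ 3 + 1) ^ n =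
      ∑ k ∈ Finset.range (n + 1), C ((-1 : ℤ) ^ k * (n.choose k : ℤ)) * (1 + X) ^ (3 * k) := by
    rw [add_pow]
    refine Finset.sum_congr rfl fun k _ => ?_
    rw [neg_pow, ← pow_mul]
    simp only [one_pow, mul_one, map_mul, map_pow, map_neg, map_one, map_natCast]
    ring
  have factor : (-(1 + X : ℤ[X]) ^ 3 + 1) ^ n = X ^ n * (-(3 + 3 * X + X ^ 2)) ^ n := by
    rw [← mul_pow]
    ring
  have coeff_eq := congrArg (fun p => coeff p n) (expand.symm.trans factor)
  simp only [finsetSum_coeff, coeff_C_mul, coeff_one_add_X_pow] at coeff_eq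
  rw [coeff_eq]
  simp [coeff_X_pow_mul', coeff_zero_eq_eval_zero]
end

section
/- Let q be a real number with 0 < q < 1 and let n, b, c be natural numbers. Then ∑_{k=-n}^{n} (-1)^k · [n+b; n+k]_q · [n+c; c+k]_q · [b+c; b+k]_q · q^{k(3k-1)/2} = (q;q)_{n+b+c} / ((q;q)_n · (q;q)_b · (q;q)_c), where k runs over the integers from -n to n (Jackson's q-analogue of Dixon's identity). -/
/-- The `q`-Pochhammer symbol `(q;q)_m = ∏_{j=1}^{m} (1 - q^j)`. -/
def qPoch (q : ℝ) (m : ℕ) : ℝ :=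
  ∏ j ∈ Finset.range m, (1 - q ^ (j + 1))

/-- The Gaussian binomial coefficient `[m; j]_q` for an integer `j`, defined to be `0`
unless `0 ≤ j ≤ m`. -/
noncomputable def qBinom (q : ℝ) (m : ℕ) (j : ℤ) : ℝ :=
  if 0 ≤ j ∧ j ≤ (m : ℤ) then qPoch q m / (qPoch q j.toNat * qPoch q (m - j.toNat)) else 0

theorem qPoch_succ (q : ℝ) (m : ℕ) : qPoch q (m + 1) = qPoch q m * (1 - q ^ (m + 1)) := by
  simp [qPoch, Finset.prod_range_succ]

theorem one_sub_pow_succ_ne_zero {q : ℝ} (hq0 : 0 < q) (hq1 : q < 1) (m : ℕ) :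
    1 - q ^ (m + 1) ≠ 0 :=
  (sub_pos.2 (pow_lt_one₀ hq0.le hq1 m.succ_ne_zero)).ne'

theorem qPoch_ne_zero {q : ℝ} (hq0 : 0 < q) (hq1 : q < 1) (m : ℕ) : qPoch q m ≠ 0 :=
  Finset.prod_ne_zero_iff.2 fun j _ => one_sub_pow_succ_ne_zero hq0 hq1 j

/-- The reciprocal `1 / (q;q)_j`, extended by `0` to negative `j`. -/
noncomputable def qPochInv (q : ℝ) (j : ℤ) : ℝ :=
  if 0 ≤ j then (qPoch q j.toNat)⁻¹ else 0

theorem qPochInv_natCast (q : ℝ) (m : ℕ) : qPochInv q m = (qPoch q m)⁻¹ := by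
  simp [qPochInv]

theorem qPochInv_of_neg (q : ℝ) {j : ℤ} (hj : j < 0) : qPochInv q j = 0 :=
  if_neg hj.not_ge

theorem qPochInv_sub_one {q : ℝ} (hq0 : 0 < q) (hq1 : q < 1) (j : ℤ) :
    qPochInv q (j - 1) = (1 - q ^ j) * qPochInv q j := by
  rcases lt_trichotomy j 0 with hj | rfl | hj
  · rw [qPochInv_of_neg q hj, qPochInv_of_neg q (by lia), mul_zero]
  · simp [qPochInv]
  · obtain ⟨m, rfl⟩ : ∃ m : ℕ, j = (m + 1 : ℕ) := ⟨j.toNat - 1, by lia⟩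
    have h : ((m + 1 : ℕ) : ℤ) - 1 = (m : ℕ) := by push_cast; ring
    have h₁ := one_sub_pow_succ_ne_zero hq0 hq1 m
    have h₂ := qPoch_ne_zero hq0 hq1 m
    rw [h, qPochInv_natCast, qPochInv_natCast, qPoch_succ, zpow_natCast]
    field_simp

theorem qBinom_eq_mul_qPochInv (q : ℝ) (m : ℕ) (j : ℤ) :
    qBinom q m j = qPoch q m * qPochInv q j * qPochInv q (m - j) := by
  by_cases h₀ : 0 ≤ j
  · by_cases h₁ : j ≤ m
    · have h : ((m : ℤ) - j).toNat = m - j.toNat := by lia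
      rw [qBinom, if_pos ⟨h₀, h₁⟩, qPochInv, qPochInv, if_pos h₀, if_pos (by lia), h,
        div_eq_mul_inv, mul_inv, mul_assoc]
    · rw [qBinom, if_neg (by tauto), qPochInv_of_neg q (j := m - j) (by lia), mul_zero]
  · rw [qBinom, if_neg (by tauto), qPochInv_of_neg q (j := j) (by lia), mul_zero, zero_mul]

theorem sum_Icc_neg_sub {M : Type*} [AddCommGroup M] (g : ℤ → M) (N : ℕ) :
    ∑ k ∈ Finset.Icc (-(N : ℤ)) N, (g (k + 1) - g k) = g (N + 1) - g (-N) := by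
  induction N with
  | zero => simp
  | succ N ih =>
    have h : Finset.Icc (-((N + 1 : ℕ) : ℤ)) (N + 1 : ℕ) =
        insert (-(N : ℤ) - 1) (insert ((N : ℤ) + 1) (Finset.Icc (-(N : ℤ)) N)) := by
      ext k
      simp only [Finset.mem_Icc, Finset.mem_insert]
      lia
    rw [h, Finset.sum_insert, Finset.sum_insert, ih]
    · push_cast
      rw [sub_add_cancel, neg_add, ← sub_eq_add_neg]
      abel
    · simp
    · simp only [Finset.mem_Icc, Finset.mem_insert]
      lia

/-- The common product of reciprocal `q`-Pochhammer symbols in the summand of Dixon's sum. -/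
noncomputable def dixonWeight (q : ℝ) (n b c : ℕ) (k : ℤ) : ℝ :=
  qPochInv q (n + k) * qPochInv q (n - k) * (qPochInv q (b + k) * qPochInv q (b - k)) *
    (qPochInv q (c + k) * qPochInv q (c - k))

theorem dixonWeight_neg (q : ℝ) (n b c : ℕ) (k : ℤ) :
    dixonWeight q n b c (-k) = dixonWeight q n b c k := by
  simp only [dixonWeight, sub_neg_eq_add, ← sub_eq_add_neg]
  ring

/-- The summand of Dixon's sum, symmetrized under `k ↦ -k`. -/
noncomputable def dixonTerm (q : ℝ) (n b c : ℕ) (k : ℤ) : ℝ :=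
  (-1) ^ k * q ^ (k * (3 * k - 1) / 2) * (1 + q ^ k) * dixonWeight q n b c k

theorem dixonTerm_eq_zero (q : ℝ) (n b c : ℕ) {k : ℤ} (hk : k < -n ∨ n < k) :
    dixonTerm q n b c k = 0 := by
  rcases hk with hk | hk
  · simp [dixonTerm, dixonWeight, qPochInv_of_neg q (j := n + k) (by lia)]
  · simp [dixonTerm, dixonWeight, qPochInv_of_neg q (j := n - k) (by lia)]

theorem two_mul_div_two_pentagonal (k : ℤ) : 2 * (k * (3 * k - 1) / 2) = k * (3 * k - 1) := by
  refine Int.mul_ediv_cancel' ?_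
  rcases Int.even_or_odd' k with ⟨m, rfl | rfl⟩
  · exact ⟨m * (3 * (2 * m) - 1), by ring⟩
  · exact ⟨(2 * m + 1) * (3 * m + 1), by ring⟩

/-- The Wilf–Zeilberger companion of `dixonTerm`. -/
noncomputable def dixonCompanion (q : ℝ) (n b c : ℕ) (k : ℤ) : ℝ :=
  -q ^ (n + 1) * (-1) ^ k * q ^ (k * (3 * k - 1) / 2 - k) *
    (qPochInv q (n + k) * qPochInv q (n + 1 - k) * (qPochInv q (b + k - 1) * qPochInv q (b - k)) *
      (qPochInv q (c + k - 1) * qPochInv q (c - k)))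

theorem dixonTerm_recurrence {q : ℝ} (hq0 : 0 < q) (hq1 : q < 1) (n b c : ℕ) (k : ℤ) :
    (1 - q ^ (n + 1)) * (1 - q ^ (n + b + 1)) * (1 - q ^ (n + c + 1)) *
          dixonTerm q (n + 1) b c k -
        (1 - q ^ (n + b + c + 1)) * dixonTerm q n b c k =
      dixonCompanion q n b c (k + 1) - dixonCompanion q n b c k := by
  have hq : q ≠ 0 := hq0.ne'
  have he : (k + 1) * (3 * (k + 1) - 1) / 2 - (k + 1) = k * (3 * k - 1) / 2 - k + 3 * k := by
    linarith [two_mul_div_two_pentagonal k, two_mul_div_two_pentagonal (k + 1)]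
  have hw : q ^ (k * (3 * k - 1) / 2) = q ^ (k * (3 * k - 1) / 2 - k) * q ^ k := by
    rw [← zpow_add₀ hq, sub_add_cancel]
  have hr : ∀ i j : ℤ, i = j - 1 → qPochInv q i = (1 - q ^ j) * qPochInv q j := by
    rintro i j rfl
    exact qPochInv_sub_one hq0 hq1 j
  have hx : q ^ k ≠ 0 := zpow_ne_zero k hq
  simp only [dixonTerm, dixonCompanion, dixonWeight]
  rw [he, hw, zpow_add₀ hq _ (3 * k), mul_comm 3 k, zpow_mul, zpow_add_one₀ (by norm_num : (-1 : ℝ) ≠ 0),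
    show (n : ℤ) + (k + 1) = n + 1 + k by ring, show (n : ℤ) + 1 - (k + 1) = n - k by ring,
    show (b : ℤ) + (k + 1) - 1 = b + k by ring, show (c : ℤ) + (k + 1) - 1 = c + k by ring,
    hr (n + k) (n + 1 + k) (by ring), hr (n - k) (n + 1 - k) (by ring),
    hr (b + k - 1) (b + k) rfl, hr (c + k - 1) (c + k) rfl,
    hr (b - (k + 1)) (b - k) (by ring), hr (c - (k + 1)) (c - k) (by ring)]
  push_cast
  simp only [zpow_add₀ hq, zpow_sub₀ hq, zpow_natCast, zpow_one, pow_add, pow_one]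
  field_simp
  ring

theorem sum_dixonTerm {q : ℝ} (hq0 : 0 < q) (hq1 : q < 1) (n b c : ℕ) :
    ∑ k ∈ Finset.Icc (-(n : ℤ)) n, dixonTerm q n b c k =
      2 * qPoch q (n + b + c) / (qPoch q n * qPoch q b * qPoch q c *
        (qPoch q (n + b) * qPoch q (n + c) * qPoch q (b + c))) := by
  have hP := qPoch_ne_zero hq0 hq1
  induction n with
  | zero =>
    have h₀ : qPochInv q 0 = 1 := by simp [qPochInv, qPoch]
    have hb := hP b
    have hc := hP c
    have hbc := hP (b + c)
    simp [dixonTerm, dixonWeight, qPochInv_natCast, h₀, show qPoch q 0 = 1 by simp [qPoch]]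
    field_simp
    ring
  | succ n ih =>
    have hsub : ∑ k ∈ Finset.Icc (-((n + 1 : ℕ) : ℤ)) (n + 1 : ℕ), dixonTerm q n b c k =
        ∑ k ∈ Finset.Icc (-(n : ℤ)) n, dixonTerm q n b c k := by
      refine (Finset.sum_subset (Finset.Icc_subset_Icc (by lia) (by lia)) fun k _ hk => ?_).symm
      rw [Finset.mem_Icc] at hk
      exact dixonTerm_eq_zero q n b c (by lia)
    have htel := sum_Icc_neg_sub (dixonCompanion q n b c) (n + 1)
    have h₁ : dixonCompanion q n b c ((n + 1 : ℕ) + 1) = 0 := by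
      simp [dixonCompanion, qPochInv_of_neg q (j := -1) (by lia)]
    have h₂ : dixonCompanion q n b c (-(n + 1 : ℕ)) = 0 := by
      simp [dixonCompanion, qPochInv_of_neg q (j := -1) (by lia)]
    simp only [← dixonTerm_recurrence hq0 hq1, Finset.sum_sub_distrib, ← Finset.mul_sum, hsub, ih,
      h₁, h₂, sub_zero] at htel
    have ha := one_sub_pow_succ_ne_zero hq0 hq1 n
    have hab := one_sub_pow_succ_ne_zero hq0 hq1 (n + b)
    have hac := one_sub_pow_succ_ne_zero hq0 hq1 (n + c)
    refine mul_left_cancel₀ (mul_ne_zero (mul_ne_zero ha hab) hac) ?_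
    rw [sub_eq_zero.1 htel, show n + 1 + b + c = n + b + c + 1 by ring,
      show n + 1 + b = n + b + 1 by ring, show n + 1 + c = n + c + 1 by ring, qPoch_succ q n,
      qPoch_succ q (n + b), qPoch_succ q (n + c), qPoch_succ q (n + b + c)]
    have := hP n
    have := hP b
    have := hP c
    have := hP (n + b)
    have := hP (n + c)
    have := hP (b + c)
    field_simp

/-- Jackson's `q`-analogue of Dixon's identity:
`∑_{k=-n}^{n} (-1)^k [n+b; n+k]_q [n+c; c+k]_q [b+c; b+k]_q q^{k(3k-1)/2}
  = (q;q)_{n+b+c} / ((q;q)_n (q;q)_b (q;q)_c)`. -/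
theorem q_dixon (q : ℝ) (hq0 : 0 < q) (hq1 : q < 1) (n b c : ℕ) :
    ∑ k ∈ Finset.Icc (-(n : ℤ)) (n : ℤ),
      (-1 : ℝ) ^ k * qBinom q (n + b) ((n : ℤ) + k) * qBinom q (n + c) ((c : ℤ) + k) *
        qBinom q (b + c) ((b : ℤ) + k) * q ^ (k * (3 * k - 1) / 2) =
      qPoch q (n + b + c) / (qPoch q n * qPoch q b * qPoch q c) := by
  have hP := qPoch_ne_zero hq0 hq1
  set u : ℤ → ℝ := fun k => (-1) ^ k * q ^ (k * (3 * k - 1) / 2) * dixonWeight q n b c k with hu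
  have hterm : ∀ k : ℤ, (-1 : ℝ) ^ k * qBinom q (n + b) ((n : ℤ) + k) *
      qBinom q (n + c) ((c : ℤ) + k) * qBinom q (b + c) ((b : ℤ) + k) *
        q ^ (k * (3 * k - 1) / 2) =
      qPoch q (n + b) * qPoch q (n + c) * qPoch q (b + c) * u k := by
    intro k
    simp only [hu, qBinom_eq_mul_qPochInv, dixonWeight]
    push_cast
    rw [show (n : ℤ) + b - (n + k) = b - k by ring, show (n : ℤ) + c - (c + k) = n - k by ring,
      show (b : ℤ) + c - (b + k) = c - k by ring]
    ring
  have hsymm : ∀ k : ℤ, u k + u (-k) = dixonTerm q n b c k := by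
    intro k
    have he : -k * (3 * -k - 1) / 2 = k * (3 * k - 1) / 2 + k := by
      linarith [two_mul_div_two_pentagonal k, two_mul_div_two_pentagonal (-k)]
    simp only [hu, dixonTerm, dixonWeight_neg, he, zpow_add₀ hq0.ne', zpow_neg, ← inv_zpow,
      inv_neg, inv_one]
    ring
  have hrefl : ∑ k ∈ Finset.Icc (-(n : ℤ)) n, u (-k) = ∑ k ∈ Finset.Icc (-(n : ℤ)) n, u k :=
    Finset.sum_equiv (Equiv.neg ℤ) (fun k => by simp only [Finset.mem_Icc, Equiv.neg_apply]; lia)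
      fun _ _ => rfl
  have hsum := sum_dixonTerm hq0 hq1 n b c
  simp only [← hsymm, Finset.sum_add_distrib, hrefl, ← two_mul, mul_div_assoc] at hsum
  simp only [hterm, ← Finset.mul_sum]
  rw [mul_left_cancel₀ two_ne_zero hsum]
  have := hP (n + b)
  have := hP (n + c)
  have := hP (b + c)
  field_simp
end

section
/- Let n be a natural number and a, b, c, d real numbers such that for every integer j with 0 ≤ j < n none of a/2 + j, 1 + a - b + j, 1 + a - c + j, 1 + a - d + j, b + c + d - a - n + j, 1 + a + n + j, and 1 + a - b - c - d + j is zero. Then ∑_{k=0}^{n} [(a)_k (1 + a/2)_k (b)_k (c)_k (d)_k (1 + 2a - b - c - d + n)_k (-n)_k] / [(a/2)_k (1 + a - b)_k (1 + a - c)_k (1 + a - d)_k (b + c + d - a - n)_k (1 + a + n)_k · k!] = [(1+a)_n (1+a-b-c)_n (1+a-b-d)_n (1+a-c-d)_n] / [(1+a-b)_n (1+a-c)_n (1+a-d)_n (1+a-b-c-d)_n] (Dougall's identity, terminating case). -/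
/-- The Pochhammer symbol (rising factorial) `(x)_k = ∏_{j=0}^{k-1} (x+j)`. -/
def poch (x : ℝ) (k : ℕ) : ℝ :=
  ∏ j ∈ Finset.range k, (x + j)

theorem poch_zero (x : ℝ) : poch x 0 = 1 := by simp [poch]

theorem poch_succ (x : ℝ) (k : ℕ) : poch x (k + 1) = poch x k * (x + k) := by
  simp [poch, Finset.prod_range_succ]

theorem poch_succ_left (x : ℝ) (k : ℕ) : poch x (k + 1) = x * poch (x + 1) k := by
  simp only [poch, Finset.prod_range_succ', Nat.cast_zero, add_zero, Nat.cast_add, Nat.cast_one]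
  rw [mul_comm]
  congr 1
  exact Finset.prod_congr rfl fun j _ => by ring

theorem poch_ne_zero {x : ℝ} {k : ℕ} (h : ∀ j < k, x + j ≠ 0) : poch x k ≠ 0 :=
  Finset.prod_ne_zero_iff.mpr fun j hj => h j (Finset.mem_range.mp hj)

theorem poch_neg_eq_zero (n : ℕ) : poch (-(n : ℝ)) (n + 1) = 0 := by
  rw [poch_succ, neg_add_cancel, mul_zero]

theorem continuous_poch (k : ℕ) : Continuous fun x => poch x k := by
  unfold poch
  fun_prop

/-- The very-well-poised factor `(a)_k (1 + a/2)_k / (a/2)_k`. -/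
theorem poch_mul_poch_half (a : ℝ) (k : ℕ) :
    poch a (k + 1) * poch (1 + a / 2) (k + 1) =
      poch (a / 2) (k + 1) * (poch (1 + a) k * (a + 2 * (k + 1))) := by
  rw [poch_succ_left a, poch_succ (1 + a / 2), poch_succ_left (a / 2), add_comm a 1,
    add_comm (a / 2) 1]
  ring

/-- The summand of Dougall's identity. -/
noncomputable def dougallTerm (n : ℕ) (a b c d : ℝ) (k : ℕ) : ℝ :=
  (poch a k * poch (1 + a / 2) k * poch b k * poch c k * poch d k *
      poch (1 + 2 * a - b - c - d + n) k * poch (-(n : ℝ)) k) /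
    (poch (a / 2) k * poch (1 + a - b) k * poch (1 + a - c) k * poch (1 + a - d) k *
      poch (b + c + d - a - n) k * poch (1 + a + n) k * (Nat.factorial k : ℝ))

/-- The closed form of Dougall's sum. -/
noncomputable def dougallValue (n : ℕ) (a b c d : ℝ) : ℝ :=
  (poch (1 + a) n * poch (1 + a - b - c) n * poch (1 + a - b - d) n *
      poch (1 + a - c - d) n) /
    (poch (1 + a - b) n * poch (1 + a - c) n * poch (1 + a - d) n *
      poch (1 + a - b - c - d) n)

/-- The ratio of consecutive values of `dougallValue`. -/
noncomputable def dougallRatio (n : ℕ) (a b c d : ℝ) : ℝ :=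
  ((1 + a + n) * (1 + a - b - c + n) * (1 + a - b - d + n) * (1 + a - c - d + n)) /
    ((1 + a - b + n) * (1 + a - c + n) * (1 + a - d + n) * (1 + a - b - c - d + n))

theorem dougallValue_succ (n : ℕ) (a b c d : ℝ) :
    dougallValue (n + 1) a b c d = dougallRatio n a b c d * dougallValue n a b c d := by
  simp only [dougallValue, dougallRatio, poch_succ]
  rw [div_mul_div_comm]
  congr 1 <;> ring

/-- The antidifference certifying the recurrence in `n` of Dougall's sum. -/
noncomputable def dougallCert (n : ℕ) (a b c d : ℝ) (m : ℕ) : ℝ :=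
  -((2 + 2 * a - b - c - d + 2 * n) * poch (1 + a) m * poch b (m + 1) * poch c (m + 1) *
      poch d (m + 1) * poch (2 + 2 * a - b - c - d + n) m * poch (-(n : ℝ)) m) /
    (((1 + a - b + n) * (1 + a - c + n) * (1 + a - d + n) * (1 + a - b - c - d + n)) *
      (Nat.factorial m : ℝ) * poch (1 + a - b) m * poch (1 + a - c) m * poch (1 + a - d) m *
      poch (b + c + d - a - n) m * poch (2 + a + n) m)

/-- No linear form occurring in a denominator of Dougall's identity is an integer. -/
structure DougallGeneric (a b c d : ℝ) : Prop where
  a_ne : ∀ z : ℤ, a ≠ z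
  b_ne : ∀ z : ℤ, a ≠ b + z
  c_ne : ∀ z : ℤ, a ≠ c + z
  d_ne : ∀ z : ℤ, a ≠ d + z
  bcd_ne : ∀ z : ℤ, a ≠ b + c + d + z

theorem sum_dougallTerm_sub (n : ℕ) {a b c d : ℝ} (h : DougallGeneric a b c d) (m : ℕ) :
    ∑ k ∈ Finset.range (m + 1),
      (dougallTerm (n + 1) a b c d k - dougallRatio n a b c d * dougallTerm n a b c d k) =
      dougallCert n a b c d m := by
  have hx (j : ℕ) : 1 + a + n + j ≠ 0 := fun h0 => h.a_ne (-1 - n - j) (by push_cast; linarith)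
  have hb (j : ℕ) : 1 + a - b + j ≠ 0 := fun h0 => h.b_ne (-1 - j) (by push_cast; linarith)
  have hc (j : ℕ) : 1 + a - c + j ≠ 0 := fun h0 => h.c_ne (-1 - j) (by push_cast; linarith)
  have hd (j : ℕ) : 1 + a - d + j ≠ 0 := fun h0 => h.d_ne (-1 - j) (by push_cast; linarith)
  have hs (j : ℕ) : 1 + a - b - c - d + j ≠ 0 := fun h0 =>
    h.bcd_ne (-1 - j) (by push_cast; linarith)
  have he (j : ℕ) : b + c + d - a - n + j ≠ 0 := fun h0 =>
    h.bcd_ne (j - n) (by push_cast; linarith)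
  have ha (j : ℕ) : a / 2 + j ≠ 0 := fun h0 => h.a_ne (-2 * j) (by push_cast; linarith)
  have hx2 (j : ℕ) : 2 + a + n + j ≠ 0 := fun h0 =>
    h.a_ne (-2 - n - j) (by push_cast; linarith)
  have hbn := hb n
  have hcn := hc n
  have hdn := hd n
  have hsn := hs n
  induction m with
  | zero =>
    simp only [zero_add, Finset.sum_range_one, dougallTerm, dougallCert, dougallRatio, poch_zero,
      poch_succ, Nat.factorial_zero, Nat.cast_one, Nat.cast_zero, add_zero, mul_one, one_mul,
      div_one]
    field_simp
    ring
  | succ m ih =>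
    rw [Finset.sum_range_succ, ih]
    have q1 := poch_ne_zero fun j (_ : j < m) => hb j
    have q2 := poch_ne_zero fun j (_ : j < m) => hc j
    have q3 := poch_ne_zero fun j (_ : j < m) => hd j
    have q4 := poch_ne_zero fun j (_ : j < m) => he j
    have q5 := poch_ne_zero fun j (_ : j < m) => hx2 j
    have q6 := poch_ne_zero fun j (_ : j < m + 1) => ha j
    have q7 : (Nat.factorial m : ℝ) ≠ 0 := Nat.cast_ne_zero.mpr m.factorial_ne_zero
    have q8 : (m : ℝ) + 1 ≠ 0 := by positivity
    have r1 := hb m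
    have r2 := hc m
    have r3 := hd m
    have r4 := he m
    have r5 := hx2 m
    have r6 : 1 + a + (n : ℝ) ≠ 0 := by simpa using hx 0
    have s1 : poch (1 + 2 * a - b - c - d + (n + 1 : ℕ)) (m + 1) =
        poch (2 + 2 * a - b - c - d + n) m * (2 + 2 * a - b - c - d + n + m) := by
      rw [← poch_succ]; congr 1; push_cast; ring
    have s2 : poch (1 + 2 * a - b - c - d + n) (m + 1) =
        (1 + 2 * a - b - c - d + n) * poch (2 + 2 * a - b - c - d + n) m := by
      rw [poch_succ_left]; congr 2; ring
    have s3 : poch (-((n + 1 : ℕ) : ℝ)) (m + 1) = -(n + 1) * poch (-(n : ℝ)) m := by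
      rw [poch_succ_left]; push_cast; congr 2; ring
    have s4 : poch (b + c + d - a - (n + 1 : ℕ)) (m + 1) =
        -(1 + a - b - c - d + n) * poch (b + c + d - a - n) m := by
      rw [poch_succ_left]; push_cast; congr 1
      · ring
      · congr 1; ring
    have s5 : poch (1 + a + (n + 1 : ℕ)) (m + 1) = poch (2 + a + n) m * (2 + a + n + m) := by
      rw [← poch_succ]; congr 1; push_cast; ring
    have s6 : poch (1 + a + n) (m + 1) = (1 + a + n) * poch (2 + a + n) m := by
      rw [poch_succ_left]; congr 2; ring
    simp only [dougallTerm, dougallCert, dougallRatio, poch_mul_poch_half, s1, s2, s3, s4, s5, s6]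
    simp only [mul_assoc (poch (a / 2) (m + 1)), mul_div_mul_left _ _ q6]
    simp only [poch_succ b (m + 1), poch_succ c (m + 1), poch_succ d (m + 1), poch_succ _ m,
      Nat.factorial_succ, Nat.cast_mul, Nat.cast_add, Nat.cast_one]
    generalize poch (1 + a - b) m = p1 at *
    generalize poch (1 + a - c) m = p2 at *
    generalize poch (1 + a - d) m = p3 at *
    generalize poch (b + c + d - a - n) m = p4 at *
    generalize poch (2 + a + n) m = p5 at *
    generalize (Nat.factorial m : ℝ) = p7 at *
    generalize poch (2 + 2 * a - b - c - d + n) m = p8 at *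
    generalize poch (-(n : ℝ)) m = p9 at *
    generalize poch (1 + a) m = p10 at *
    generalize poch b m * (b + m) = p11 at *
    generalize poch c m * (c + m) = p12 at *
    generalize poch d m * (d + m) = p13 at *
    field_simp
    ring

theorem dougall_generic (n : ℕ) {a b c d : ℝ} (h : DougallGeneric a b c d) :
    ∑ k ∈ Finset.range (n + 1), dougallTerm n a b c d k = dougallValue n a b c d := by
  induction n with
  | zero => simp [dougallTerm, dougallValue, poch_zero]
  | succ n ih =>
    have key := sum_dougallTerm_sub n h (n + 1)
    have hcert : dougallCert n a b c d (n + 1) = 0 := by simp [dougallCert, poch_neg_eq_zero]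
    have hterm : dougallTerm n a b c d (n + 1) = 0 := by simp [dougallTerm, poch_neg_eq_zero]
    rw [hcert, Finset.sum_sub_distrib, ← Finset.mul_sum,
      Finset.sum_range_succ (dougallTerm n a b c d) (n + 1), hterm, add_zero, ih,
      ← dougallValue_succ] at key
    exact sub_eq_zero.mp key

theorem dense_dougallGeneric (b c d : ℝ) : Dense {a | DougallGeneric a b c d} := by
  have hcount (x : ℝ) : (Set.range fun z : ℤ => x + z).Countable := Set.countable_range _
  have hc := ((((hcount 0).union (hcount b)).union (hcount c)).union (hcount d)).union
    (hcount (b + c + d))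
  refine (hc.dense_compl ℝ).mono fun a ha => ?_
  simp only [Set.mem_compl_iff, Set.mem_union, Set.mem_range, not_or, not_exists, zero_add] at ha
  obtain ⟨⟨⟨⟨h0, h1⟩, h2⟩, h3⟩, h4⟩ := ha
  exact ⟨fun z hz => h0 z hz.symm, fun z hz => h1 z hz.symm, fun z hz => h2 z hz.symm,
    fun z hz => h3 z hz.symm, fun z hz => h4 z hz.symm⟩

/-- Dougall's identity (terminating very-well-poised ₇F₆ case). -/
theorem dougall (n : ℕ) (a b c d : ℝ)
    (h : ∀ j : ℕ, j < n →
      a / 2 + j ≠ 0 ∧ 1 + a - b + j ≠ 0 ∧ 1 + a - c + j ≠ 0 ∧ 1 + a - d + j ≠ 0 ∧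
      b + c + d - a - n + j ≠ 0 ∧ 1 + a + n + j ≠ 0 ∧ 1 + a - b - c - d + j ≠ 0) :
    ∑ k ∈ Finset.range (n + 1),
      (poch a k * poch (1 + a / 2) k * poch b k * poch c k * poch d k *
          poch (1 + 2 * a - b - c - d + n) k * poch (-(n : ℝ)) k) /
        (poch (a / 2) k * poch (1 + a - b) k * poch (1 + a - c) k * poch (1 + a - d) k *
          poch (b + c + d - a - n) k * poch (1 + a + n) k * (Nat.factorial k : ℝ)) =
      (poch (1 + a) n * poch (1 + a - b - c) n * poch (1 + a - b - d) n *
          poch (1 + a - c - d) n) /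
        (poch (1 + a - b) n * poch (1 + a - c) n * poch (1 + a - d) n *
          poch (1 + a - b - c - d) n) := by
  have hcont {f : ℝ → ℝ} (hf : Continuous f) (k : ℕ) : ContinuousAt (fun a => poch (f a) k) a :=
    ((continuous_poch k).comp hf).continuousAt
  have hterm : ∀ k ∈ Finset.range (n + 1),
      ContinuousAt (fun a => dougallTerm n a b c d k) a := by
    intro k hk
    have hk' : k ≤ n := Nat.lt_succ_iff.mp (Finset.mem_range.mp hk)
    have h' := fun j (hj : j < k) => h j (hj.trans_le hk')
    have q1 := poch_ne_zero fun j hj => (h' j hj).1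
    have q2 := poch_ne_zero fun j hj => (h' j hj).2.1
    have q3 := poch_ne_zero fun j hj => (h' j hj).2.2.1
    have q4 := poch_ne_zero fun j hj => (h' j hj).2.2.2.1
    have q5 := poch_ne_zero fun j hj => (h' j hj).2.2.2.2.1
    have q6 := poch_ne_zero fun j hj => (h' j hj).2.2.2.2.2.1
    have q7 : (Nat.factorial k : ℝ) ≠ 0 := Nat.cast_ne_zero.mpr k.factorial_ne_zero
    unfold dougallTerm
    refine ContinuousAt.div ?_ ?_ (by simp [*])
    all_goals
      repeat' apply ContinuousAt.mul
      all_goals first | exact continuousAt_const | exact hcont (by fun_prop) k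
  have hvalue : ContinuousAt (fun a => dougallValue n a b c d) a := by
    have q1 := poch_ne_zero fun j hj => (h j hj).2.1
    have q2 := poch_ne_zero fun j hj => (h j hj).2.2.1
    have q3 := poch_ne_zero fun j hj => (h j hj).2.2.2.1
    have q4 := poch_ne_zero fun j hj => (h j hj).2.2.2.2.2.2
    unfold dougallValue
    refine ContinuousAt.div ?_ ?_ (by simp [*])
    all_goals
      repeat' apply ContinuousAt.mul
      all_goals exact hcont (by fun_prop) n
  have hsum : ContinuousAt (fun a => ∑ k ∈ Finset.range (n + 1), dougallTerm n a b c d k) a :=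
    tendsto_finsetSum _ hterm
  have : (nhdsWithin a {a | DougallGeneric a b c d}).NeBot :=
    mem_closure_iff_nhdsWithin_neBot.mp (dense_dougallGeneric b c d a)
  refine tendsto_nhds_unique_of_eventuallyEq (l := nhdsWithin a {a | DougallGeneric a b c d})
    (hsum.mono_left nhdsWithin_le_nhds)
    (hvalue.mono_left nhdsWithin_le_nhds) ?_
  filter_upwards [self_mem_nhdsWithin] with a' ha'
  exact dougall_generic n ha'
end

section
/- For every natural number n and every real number x, ∑_{k=0}^{n} (-1)^k · C(n,k) · C(n+k,k) · ((1-x)/2)^k = (1/2^n) · ∑_{k=0}^{n} C(n,k)² · (x-1)^{n-k} · (x+1)^k; i.e., the hypergeometric representation ₂F₁(-n, n+1; 1; (1-x)/2) of the Legendre polynomial P_n(x) agrees with its product representation. -/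
open Finset in
/-- A form of Vandermonde's identity. -/
theorem sum_choose_mul_choose_eq_add_choose (n k : ℕ) :
    ∑ j ∈ range (k + 1), n.choose j * k.choose j = (n + k).choose k := by
  rw [Nat.add_choose_eq, Nat.sum_antidiagonal_eq_sum_range_succ_mk]
  refine sum_congr rfl fun j hj => ?_
  rw [Nat.choose_symm (Nat.lt_succ_iff.mp (mem_range.mp hj))]

open Finset in
theorem pow_mul_add_one_pow_sub {R : Type*} [CommSemiring R] (y : R) {n j : ℕ} (hj : j ≤ n) :
    y ^ j * (y + 1) ^ (n - j) = ∑ k ∈ Ico j (n + 1), ((n - j).choose (k - j) : R) * y ^ k := by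
  rw [add_pow, mul_sum, sum_Ico_eq_sum_range, Nat.sub_add_comm hj]
  refine sum_congr rfl fun i _ => ?_
  rw [Nat.add_sub_cancel_left, pow_add, one_pow]
  ring

open Finset in
theorem sum_choose_sq_mul_pow_mul_add_one_pow {R : Type*} [CommSemiring R] (n : ℕ) (y : R) :
    ∑ k ∈ range (n + 1), (n.choose k : R) ^ 2 * y ^ (n - k) * (y + 1) ^ k =
      ∑ k ∈ range (n + 1), (n.choose k : R) * ((n + k).choose k : R) * y ^ k := by
  calc
    _ = ∑ j ∈ range (n + 1), (n.choose j : R) ^ 2 * (y ^ j * (y + 1) ^ (n - j)) := by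
      rw [← sum_range_reflect]
      refine sum_congr rfl fun j hj => ?_
      have hj' : j ≤ n := Nat.lt_succ_iff.mp (mem_range.mp hj)
      rw [Nat.add_sub_cancel, Nat.choose_symm hj', Nat.sub_sub_self hj', mul_assoc]
    _ = ∑ j ∈ range (n + 1), ∑ k ∈ Ico j (n + 1),
          (n.choose j : R) ^ 2 * (((n - j).choose (k - j) : R) * y ^ k) := by
      refine sum_congr rfl fun j hj => ?_
      rw [pow_mul_add_one_pow_sub y (Nat.lt_succ_iff.mp (mem_range.mp hj)), mul_sum]
    _ = ∑ k ∈ range (n + 1), ∑ j ∈ range (k + 1),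
          (n.choose j : R) ^ 2 * (((n - j).choose (k - j) : R) * y ^ k) :=
      sum_comm' fun j k => by simp only [mem_range, mem_Ico]; omega
    _ = _ := by
      refine sum_congr rfl fun k hk => ?_
      rw [← sum_choose_mul_choose_eq_add_choose, Nat.cast_sum, mul_sum, sum_mul]
      refine sum_congr rfl fun j hj => ?_
      have h : (n.choose k : R) * k.choose j = n.choose j * (n - j).choose (k - j) := by
        rw [← Nat.cast_mul, Nat.choose_mul (Nat.lt_succ_iff.mp (mem_range.mp hj)), Nat.cast_mul]
      rw [Nat.cast_mul, mul_left_comm (n.choose k : R), h]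
      ring

/-- The hypergeometric representation `₂F₁(-n, n+1; 1; (1-x)/2)` of the Legendre
polynomial `P_n(x)` agrees with its product representation. -/
theorem legendre_hypergeometric_eq_product (n : ℕ) (x : ℝ) :
    ∑ k ∈ Finset.range (n + 1),
      (-1 : ℝ) ^ k * (n.choose k : ℝ) * ((n + k).choose k : ℝ) * ((1 - x) / 2) ^ k =
      (1 / 2 ^ n) * ∑ k ∈ Finset.range (n + 1),
        ((n.choose k : ℝ)) ^ 2 * (x - 1) ^ (n - k) * (x + 1) ^ k := by
  have h := sum_choose_sq_mul_pow_mul_add_one_pow n ((x - 1) / 2)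
  have hl : ∀ k, (-1 : ℝ) ^ k * (n.choose k : ℝ) * ((n + k).choose k : ℝ) * ((1 - x) / 2) ^ k =
      (n.choose k : ℝ) * ((n + k).choose k : ℝ) * ((x - 1) / 2) ^ k := fun k => by
    rw [show (x - 1) / 2 = -1 * ((1 - x) / 2) by ring, mul_pow]
    ring
  rw [Finset.sum_congr rfl fun k _ => hl k, ← h, Finset.mul_sum]
  refine Finset.sum_congr rfl fun k hk => ?_
  have hk' : n - k + k = n := Nat.sub_add_cancel (Nat.lt_succ_iff.mp (Finset.mem_range.mp hk))
  have h2 : (2 : ℝ) ^ n = 2 ^ (n - k) * 2 ^ k := by rw [← pow_add, hk']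
  rw [show (x - 1) / 2 + 1 = (x + 1) / 2 by ring, div_pow, div_pow, h2]
  field_simp
end

section
/- For every natural number n and every real number x, ∑_{k=0}^{n} (-1)^k · C(n,k) · C(n+k,k) · ((1-x)/2)^k = (1/2^n) · ∑_{k=0}^{⌊n/2⌋} (-1)^k · C(n,k) · C(2n-2k,n) · x^{n-2k}; i.e., the hypergeometric representation of the Legendre polynomial P_n(x) agrees with its monomial representation. -/
open Polynomial in
/-- The coefficient of `X ^ n` in `((X + x) ^ 2 - 1) ^ n`, expanded in powers of `X + x`. -/
lemma coeff_sq_sub_one_pow_eq_sum_monomial (n : ℕ) (x : ℝ) :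
    (((X + C x) ^ 2 - 1 : ℝ[X]) ^ n).coeff n =
      ∑ k ∈ Finset.range (n / 2 + 1),
        (-1 : ℝ) ^ k * (n.choose k : ℝ) * ((2 * n - 2 * k).choose n : ℝ) * x ^ (n - 2 * k) := by
  have expand : ((X + C x) ^ 2 - 1 : ℝ[X]) ^ n = ∑ k ∈ Finset.range (n + 1),
      C ((-1 : ℝ) ^ k * (n.choose k : ℝ)) * (X + C x) ^ (2 * n - 2 * k) := by
    rw [sub_eq_neg_add, add_pow]
    refine Finset.sum_congr rfl fun k _ => ?_
    rw [← pow_mul, Nat.mul_sub]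
    simp only [map_mul, map_pow, map_neg, map_one, map_natCast]
    ring
  rw [expand, finsetSum_coeff]
  simp only [coeff_C_mul, coeff_X_add_C_pow]
  symm
  apply Finset.sum_subset_zero_on_sdiff
  · intro k hk
    simp only [Finset.mem_range] at hk ⊢
    omega
  · intro k hk
    simp only [Finset.mem_sdiff, Finset.mem_range] at hk
    rw [Nat.choose_eq_zero_of_lt (show 2 * n - 2 * k < n by omega)]
    simp
  · intro k hk
    rw [show 2 * n - 2 * k - n = n - 2 * k by omega]
    ring

open Polynomial in
/-- The coefficient of `X ^ n` in `((X + x) ^ 2 - 1) ^ n`, expanded in powers of `X + x - 1`. -/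
lemma coeff_sq_sub_one_pow_eq_sum_hypergeometric (n : ℕ) (x : ℝ) :
    (((X + C x) ^ 2 - 1 : ℝ[X]) ^ n).coeff n =
      2 ^ n * ∑ k ∈ Finset.range (n + 1),
        (-1 : ℝ) ^ k * (n.choose k : ℝ) * ((n + k).choose k : ℝ) * ((1 - x) / 2) ^ k := by
  have expand : ((X + C x) ^ 2 - 1 : ℝ[X]) ^ n = ∑ k ∈ Finset.range (n + 1),
      C (2 ^ (n - k) * (n.choose k : ℝ)) * (X + C (x - 1)) ^ (n + k) := by
    have factor : ((X + C x) ^ 2 - 1 : ℝ[X]) =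
        (X + C (x - 1)) * ((X + C (x - 1)) + C 2) := by
      simp only [map_sub, map_one, map_ofNat]
      ring
    rw [factor, mul_pow, add_pow _ (C 2), Finset.mul_sum]
    refine Finset.sum_congr rfl fun k _ => ?_
    simp only [map_mul, map_pow, map_natCast]
    ring
  rw [expand, finsetSum_coeff, Finset.mul_sum]
  refine Finset.sum_congr rfl fun k hk => ?_
  have two_pow : (2 : ℝ) ^ n = 2 ^ (n - k) * 2 ^ k := by
    rw [← pow_add, Nat.sub_add_cancel (Finset.mem_range_succ_iff.mp hk)]
  have base : (x - 1) ^ k = (-1) ^ k * (2 ^ k * ((1 - x) / 2) ^ k) := by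
    rw [← mul_pow, ← mul_pow]
    congr 1
    ring
  rw [coeff_C_mul, coeff_X_add_C_pow, Nat.add_sub_cancel_left, Nat.choose_symm_add, base, two_pow]
  ring

/-- The hypergeometric representation of the Legendre polynomial `P_n(x)` agrees with
its monomial representation. -/
theorem legendre_hypergeometric_eq_monomial (n : ℕ) (x : ℝ) :
    ∑ k ∈ Finset.range (n + 1),
      (-1 : ℝ) ^ k * (n.choose k : ℝ) * ((n + k).choose k : ℝ) * ((1 - x) / 2) ^ k =
      (1 / 2 ^ n) * ∑ k ∈ Finset.range (n / 2 + 1),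
        (-1 : ℝ) ^ k * (n.choose k : ℝ) * ((2 * n - 2 * k).choose n : ℝ) * x ^ (n - 2 * k) := by
  rw [← coeff_sq_sub_one_pow_eq_sum_monomial, coeff_sq_sub_one_pow_eq_sum_hypergeometric,
    ← mul_assoc, one_div, inv_mul_cancel₀ (by positivity), one_mul]
end

section
/- For every real number x with |x| ≤ 1, the series ∑_{k=0}^∞ (k!)² · 4^k · x^{2k+2} / ((k+1) · (2k+1)!) converges and its sum equals (arcsin x)². -/
open Nat

/-- The coefficient of `x ^ (2 * k + 2)` in the power series of `arcsin x ^ 2`. -/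
noncomputable def arcsinSqCoeff (k : ℕ) : ℝ :=
  (k ! : ℝ) ^ 2 * 4 ^ k / (((k : ℝ) + 1) * ((2 * k + 1)! : ℝ))

lemma arcsinSqCoeff_nonneg (k : ℕ) : 0 ≤ arcsinSqCoeff k := by
  unfold arcsinSqCoeff
  positivity

lemma arcsinSqCoeff_zero : arcsinSqCoeff 0 = 1 := by
  simp [arcsinSqCoeff]

lemma arcsinSqCoeff_succ (k : ℕ) :
    (2 * k + 4) * (2 * k + 3) * arcsinSqCoeff (k + 1) = (2 * k + 2) ^ 2 * arcsinSqCoeff k := by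
  have h : (2 * (k + 1) + 1)! = (2 * k + 3) * ((2 * k + 2) * (2 * k + 1)!) := by
    rw [show 2 * (k + 1) + 1 = (2 * k + 1) + 1 + 1 by ring, Nat.factorial_succ, Nat.factorial_succ]
  unfold arcsinSqCoeff
  rw [h, Nat.factorial_succ]
  push_cast
  field_simp
  ring

lemma arcsinSqCoeff_mul_le (n : ℕ) :
    (2 * n + 2) * (2 * n + 1) * arcsinSqCoeff n ≤ 2 * (n + 1) := by
  induction n with
  | zero => simp [arcsinSqCoeff_zero]
  | succ n ih =>
    have h := arcsinSqCoeff_succ n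
    have h2 : (2 * (n : ℝ) + 1) * arcsinSqCoeff n ≤ 1 := by
      have : (0 : ℝ) < n + 1 := by positivity
      nlinarith
    have h3 : (2 * (n : ℝ) + 2) * arcsinSqCoeff n ≤ 2 := by
      nlinarith [arcsinSqCoeff_nonneg n, mul_nonneg (Nat.cast_nonneg (α := ℝ) n)
        (arcsinSqCoeff_nonneg n)]
    have h4 : (2 * (n : ℝ) + 2) ^ 2 * arcsinSqCoeff n ≤ 2 * (n + 1 + 1) := by
      have : (2 * (n : ℝ) + 2) ^ 2 * arcsinSqCoeff n =
        (2 * n + 1) * ((2 * n + 1) * arcsinSqCoeff n) + 2 * ((2 * n + 1) * arcsinSqCoeff n)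
          + arcsinSqCoeff n := by ring
      have h5 : (2 * (n : ℝ) + 1) * ((2 * n + 1) * arcsinSqCoeff n) ≤ (2 * n + 1) * 1 := by
        gcongr
      nlinarith [arcsinSqCoeff_nonneg n, mul_nonneg (Nat.cast_nonneg (α := ℝ) n)
        (arcsinSqCoeff_nonneg n)]
    push_cast
    linarith

lemma nonneg_of_second_deriv_nonneg {f f' f'' : ℝ → ℝ} {b : ℝ} (hb : 0 ≤ b)
    (hf : ∀ t, HasDerivAt f (f' t) t) (hf' : ∀ t, HasDerivAt f' (f'' t) t)
    (h0 : f 0 = 0) (h0' : f' 0 = 0) (h : ∀ t ∈ Set.Icc 0 b, 0 ≤ f'' t) : 0 ≤ f b := by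
  have mono {g g' : ℝ → ℝ} (hg : ∀ t, HasDerivAt g (g' t) t)
      (hg' : ∀ t ∈ Set.Icc 0 b, 0 ≤ g' t) : MonotoneOn g (Set.Icc 0 b) :=
    monotoneOn_of_hasDerivWithinAt_nonneg (convex_Icc 0 b)
      (fun t _ => (hg t).continuousAt.continuousWithinAt)
      (fun t _ => (hg t).hasDerivWithinAt) fun t ht => hg' t (interior_subset ht)
  have hz : (0 : ℝ) ∈ Set.Icc 0 b := ⟨le_rfl, hb⟩
  have h1 : ∀ t ∈ Set.Icc 0 b, 0 ≤ f' t := fun t ht => h0' ▸ mono hf' h hz ht ht.1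
  exact h0 ▸ mono hf h1 hz ⟨hb, le_rfl⟩ hb

/-- The remainder of the series for `t ^ 2` in powers of `sin t`. -/
noncomputable def arcsinSqRemainder (n : ℕ) (t : ℝ) : ℝ :=
  t ^ 2 - ∑ k ∈ Finset.range n, arcsinSqCoeff k * Real.sin t ^ (2 * k + 2)

/-- The derivative of `arcsinSqRemainder n`. -/
noncomputable def arcsinSqRemainderDeriv (n : ℕ) (t : ℝ) : ℝ :=
  2 * t - ∑ k ∈ Finset.range n,
    arcsinSqCoeff k * ((2 * k + 2) * Real.sin t ^ (2 * k + 1) * Real.cos t)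

lemma hasDerivAt_arcsinSqRemainder (n : ℕ) (t : ℝ) :
    HasDerivAt (arcsinSqRemainder n) (arcsinSqRemainderDeriv n t) t := by
  refine HasDerivAt.sub (by simpa using hasDerivAt_pow 2 t) (HasDerivAt.fun_sum fun k _ => ?_)
  simpa using ((Real.hasDerivAt_sin t).fun_pow (2 * k + 2)).const_mul (arcsinSqCoeff k)

lemma hasDerivAt_arcsinSqRemainderDeriv (n : ℕ) (t : ℝ) :
    HasDerivAt (arcsinSqRemainderDeriv n)
      ((2 * n + 2) * (2 * n + 1) * arcsinSqCoeff n * Real.sin t ^ (2 * n)) t := by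
  induction n with
  | zero =>
    have h := (hasDerivAt_id t).const_mul 2
    have e : arcsinSqRemainderDeriv 0 = fun t => 2 * t := by
      funext t
      simp [arcsinSqRemainderDeriv]
    rw [e]
    simpa [arcsinSqCoeff_zero] using h
  | succ n ih =>
    have h := ((((Real.hasDerivAt_sin t).fun_pow (2 * n + 1)).const_mul
      (2 * (n : ℝ) + 2)).mul (Real.hasDerivAt_cos t)).const_mul (arcsinSqCoeff n)
    have e : arcsinSqRemainderDeriv (n + 1) = fun t => arcsinSqRemainderDeriv n t -
        arcsinSqCoeff n * ((2 * n + 2) * Real.sin t ^ (2 * n + 1) * Real.cos t) := by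
      funext t
      simp only [arcsinSqRemainderDeriv, Finset.sum_range_succ]
      ring
    rw [e]
    refine (ih.sub h).congr_deriv ?_
    have hc := arcsinSqCoeff_succ n
    have hs := Real.cos_sq' t
    push_cast
    rw [show (2 * ((n : ℝ) + 1) + 2) * (2 * (n + 1) + 1) * arcsinSqCoeff (n + 1) =
      (2 * n + 2) ^ 2 * arcsinSqCoeff n by rw [← hc]; ring]
    linear_combination (-(2 * (n : ℝ) + 2) * (2 * n + 1) * arcsinSqCoeff n *
      Real.sin t ^ (2 * n)) * hs

lemma arcsinSqRemainder_zero_right (n : ℕ) : arcsinSqRemainder n 0 = 0 := by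
  simp [arcsinSqRemainder]

lemma arcsinSqRemainderDeriv_zero_right (n : ℕ) : arcsinSqRemainderDeriv n 0 = 0 := by
  simp [arcsinSqRemainderDeriv]

lemma arcsinSqRemainder_nonneg (n : ℕ) {t : ℝ} (ht : 0 ≤ t) : 0 ≤ arcsinSqRemainder n t := by
  refine nonneg_of_second_deriv_nonneg ht (hasDerivAt_arcsinSqRemainder n)
    (hasDerivAt_arcsinSqRemainderDeriv n) (arcsinSqRemainder_zero_right n)
    (arcsinSqRemainderDeriv_zero_right n) fun u _ => ?_
  have := arcsinSqCoeff_nonneg n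
  have := (even_two_mul n).pow_nonneg (Real.sin u)
  positivity

lemma arcsinSqRemainder_le (n : ℕ) {t : ℝ} (ht : 0 ≤ t) (ht' : t ≤ Real.pi / 2) :
    arcsinSqRemainder n t ≤ (n + 1) * Real.sin t ^ (2 * n) * t ^ 2 := by
  set M := ((n : ℝ) + 1) * Real.sin t ^ (2 * n) with hM
  rw [← sub_nonneg]
  refine nonneg_of_second_deriv_nonneg
    (f := fun u => M * u ^ 2 - arcsinSqRemainder n u)
    (f' := fun u => M * (2 * u) - arcsinSqRemainderDeriv n u) ht
    (fun u => (HasDerivAt.const_mul M (by simpa using hasDerivAt_pow 2 u)).sub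
      (hasDerivAt_arcsinSqRemainder n u))
    (fun u => (((hasDerivAt_id u).const_mul 2).const_mul M).sub
      (hasDerivAt_arcsinSqRemainderDeriv n u))
    (by simp [arcsinSqRemainder_zero_right])
    (by simp [arcsinSqRemainderDeriv_zero_right]) fun u hu => ?_
  have hs : 0 ≤ Real.sin u :=
    Real.sin_nonneg_of_nonneg_of_le_pi hu.1 (by linarith [hu.2, Real.pi_pos])
  have hsin : Real.sin u ≤ Real.sin t :=
    Real.sin_le_sin_of_le_of_le_pi_div_two (by linarith [hu.1, Real.pi_pos]) ht' hu.2
  have : (2 * n + 2) * (2 * n + 1) * arcsinSqCoeff n * Real.sin u ^ (2 * n) ≤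
      2 * (n + 1) * Real.sin t ^ (2 * n) :=
    mul_le_mul (arcsinSqCoeff_mul_le n) (pow_le_pow_left₀ hs hsin _) (pow_nonneg hs _)
      (by positivity)
  rw [sub_nonneg, hM]
  linarith

lemma hasSum_arcsinSqCoeff_mul_sin_pow {t : ℝ} (ht : 0 ≤ t) (ht' : t < Real.pi / 2) :
    HasSum (fun k => arcsinSqCoeff k * Real.sin t ^ (2 * k + 2)) (t ^ 2) := by
  have hs : 0 ≤ Real.sin t :=
    Real.sin_nonneg_of_nonneg_of_le_pi ht (by linarith [Real.pi_pos])
  have hs1 : Real.sin t < 1 := by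
    rw [← Real.sin_pi_div_two]
    exact Real.sin_lt_sin_of_lt_of_le_pi_div_two (by linarith [Real.pi_pos]) le_rfl ht'
  rw [hasSum_iff_tendsto_nat_of_nonneg
    fun k => mul_nonneg (arcsinSqCoeff_nonneg k) (pow_nonneg hs _)]
  have hr0 : 0 ≤ Real.sin t ^ 2 := by positivity
  have hr : Real.sin t ^ 2 < 1 := pow_lt_one₀ hs hs1 two_ne_zero
  have hlim : Filter.Tendsto (fun n : ℕ => ((n : ℝ) + 1) * Real.sin t ^ (2 * n) * t ^ 2)
      Filter.atTop (nhds 0) := by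
    have h := ((tendsto_self_mul_const_pow_of_lt_one hr0 hr).add
      (tendsto_pow_atTop_nhds_zero_of_lt_one hr0 hr)).mul_const (t ^ 2)
    simpa [add_mul, pow_mul] using h
  have hR := squeeze_zero (fun n => arcsinSqRemainder_nonneg n ht)
    (fun n => arcsinSqRemainder_le n ht ht'.le) hlim
  have h := hR.const_sub (t ^ 2)
  rw [sub_zero] at h
  exact h.congr fun n => sub_sub_cancel _ _

lemma hasSum_arcsinSqCoeff : HasSum arcsinSqCoeff ((Real.pi / 2) ^ 2) := by
  have hb (n : ℕ) : ∑ k ∈ Finset.range n, arcsinSqCoeff k ≤ (Real.pi / 2) ^ 2 := by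
    simpa [arcsinSqRemainder] using arcsinSqRemainder_nonneg n Real.pi_div_two_pos.le
  have hsum : Summable arcsinSqCoeff := summable_of_sum_range_le arcsinSqCoeff_nonneg hb
  have hle : ∀ t ∈ Set.Ioo 0 (Real.pi / 2), t ^ 2 ≤ ∑' k, arcsinSqCoeff k := fun t ht =>
    hasSum_le (fun k => mul_le_of_le_one_right (arcsinSqCoeff_nonneg k)
      (pow_le_one₀ (Real.sin_nonneg_of_nonneg_of_le_pi ht.1.le
        (by linarith [ht.2, Real.pi_pos])) (Real.sin_le_one t)))
      (hasSum_arcsinSqCoeff_mul_sin_pow ht.1.le ht.2) hsum.hasSum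
  have hge : (Real.pi / 2) ^ 2 ≤ ∑' k, arcsinSqCoeff k := by
    have hcont : Filter.Tendsto (fun t : ℝ => t ^ 2) (nhdsWithin (Real.pi / 2)
        (Set.Iio (Real.pi / 2))) (nhds ((Real.pi / 2) ^ 2)) :=
      (continuous_pow 2).continuousAt.tendsto.mono_left nhdsWithin_le_nhds
    refine le_of_tendsto hcont ?_
    filter_upwards [Ioo_mem_nhdsLT Real.pi_div_two_pos] with t ht using hle t ht
  rw [le_antisymm hge (Real.tsum_le_of_sum_range_le arcsinSqCoeff_nonneg hb)]
  exact hsum.hasSum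

/-- For `|x| ≤ 1`, `∑_{k=0}^∞ (k!)²·4^k·x^{2k+2} / ((k+1)·(2k+1)!) = (arcsin x)²`. -/
theorem arcsin_sq_series (x : ℝ) (hx : |x| ≤ 1) :
    HasSum (fun k : ℕ =>
      ((k ! : ℝ)) ^ 2 * 4 ^ k * x ^ (2 * k + 2) / (((k : ℝ) + 1) * ((2 * k + 1)! : ℝ)))
      ((Real.arcsin x) ^ 2) := by
  have hpow (k : ℕ) : x ^ (2 * k + 2) = |x| ^ (2 * k + 2) :=
    (Even.pow_abs ⟨k + 1, by ring⟩ x).symm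
  have harc : Real.arcsin x ^ 2 = Real.arcsin |x| ^ 2 := by
    rcases abs_choice x with h | h <;> simp [h]
  have hterm : (fun k : ℕ =>
      ((k ! : ℝ)) ^ 2 * 4 ^ k * x ^ (2 * k + 2) / (((k : ℝ) + 1) * ((2 * k + 1)! : ℝ))) =
      fun k => arcsinSqCoeff k * |x| ^ (2 * k + 2) := by
    funext k
    rw [hpow, arcsinSqCoeff]
    ring
  rw [harc, hterm]
  rcases hx.lt_or_eq with h | h
  · have := hasSum_arcsinSqCoeff_mul_sin_pow (Real.arcsin_nonneg.2 (abs_nonneg x))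
      (Real.arcsin_lt_pi_div_two.2 h)
    rwa [Real.sin_arcsin (by linarith [abs_nonneg x]) hx] at this
  · simpa [h] using hasSum_arcsinSqCoeff
end

section
/- Let f : ℝ → ℝ be given by f(x) = (arcsin x)². Then for every x in the open interval (-1, 1), f is three times differentiable at x and (x² - 1) · f'''(x) + 3x · f''(x) + f'(x) = 0, i.e., (arcsin x)² satisfies the holonomic differential equation (x²-1)F''' + 3xF'' + F' = 0 on (-1,1). -/
open Set in
lemma hasDerivAt_deriv_of_hasDerivAt_Ioo {f g : ℝ → ℝ} {a b x c : ℝ} (hx : x ∈ Ioo a b)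
    (h : ∀ y ∈ Ioo a b, HasDerivAt f (g y) y) (hg : HasDerivAt g c x) :
    HasDerivAt (deriv f) c x :=
  hg.congr_of_eventuallyEq <|
    Filter.eventually_of_mem (isOpen_Ioo.mem_nhds hx) fun y hy => (h y hy).deriv

lemma hasDerivAt_arcsin_sq {x : ℝ} (hx : x ∈ Set.Ioo (-1 : ℝ) 1) :
    HasDerivAt (fun y => Real.arcsin y ^ 2) (2 * Real.arcsin x / √(1 - x ^ 2)) x := by
  refine ((Real.hasDerivAt_arcsin hx.1.ne' hx.2.ne).pow 2).congr_deriv ?_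
  simp only [Nat.cast_ofNat, Nat.add_one_sub_one, pow_one]
  ring

lemma hasDerivAt_two_mul_arcsin_div_sqrt {x : ℝ} (hx : x ∈ Set.Ioo (-1 : ℝ) 1) :
    HasDerivAt (fun y => 2 * Real.arcsin y / √(1 - y ^ 2))
      ((2 + x * (2 * Real.arcsin x / √(1 - x ^ 2))) / (1 - x ^ 2)) x := by
  have hpos : 0 < 1 - x ^ 2 := by nlinarith [hx.1, hx.2]
  have hs : √(1 - x ^ 2) ≠ 0 := (Real.sqrt_pos.2 hpos).ne'
  have hsq : √(1 - x ^ 2) ^ 2 = 1 - x ^ 2 := Real.sq_sqrt hpos.le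
  have hsqrt : HasDerivAt (fun y : ℝ => √(1 - y ^ 2)) (-(2 * x) / (2 * √(1 - x ^ 2))) x := by
    simpa using ((hasDerivAt_pow 2 x).const_sub 1).sqrt hpos.ne'
  refine (((Real.hasDerivAt_arcsin hx.1.ne' hx.2.ne).const_mul 2).div hsqrt hs).congr_deriv ?_
  rw [hsq]
  congr 1
  field_simp
  ring


/-- `f(x) = (arcsin x)²` is three times differentiable on `(-1,1)` and satisfies the
holonomic differential equation `(x²-1)f''' + 3xf'' + f' = 0` there. -/
theorem arcsin_sq_holonomic_ode
    (f : ℝ → ℝ) (hf : ∀ x : ℝ, f x = (Real.arcsin x) ^ 2) :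
    ∀ x ∈ Set.Ioo (-1 : ℝ) 1,
      DifferentiableAt ℝ f x ∧
      DifferentiableAt ℝ (deriv f) x ∧
      DifferentiableAt ℝ (deriv (deriv f)) x ∧
      (x ^ 2 - 1) * deriv (deriv (deriv f)) x + 3 * x * deriv (deriv f) x + deriv f x = 0 := by
  intro x hx
  obtain rfl : f = fun y => Real.arcsin y ^ 2 := funext hf
  have h₁ := hasDerivAt_arcsin_sq hx
  have h₂ : ∀ y ∈ Set.Ioo (-1 : ℝ) 1, HasDerivAt (deriv fun z => Real.arcsin z ^ 2) _ y :=
    fun y hy => hasDerivAt_deriv_of_hasDerivAt_Ioo hy (fun z hz => hasDerivAt_arcsin_sq hz)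
      (hasDerivAt_two_mul_arcsin_div_sqrt hy)
  have hne : 1 - x ^ 2 ≠ 0 := by nlinarith [hx.1, hx.2]
  have h₃ := hasDerivAt_deriv_of_hasDerivAt_Ioo hx h₂ <|
    (((hasDerivAt_id' x).mul (hasDerivAt_two_mul_arcsin_div_sqrt hx)).const_add 2).div
      ((hasDerivAt_pow 2 x).const_sub 1) hne
  refine ⟨h₁.differentiableAt, (h₂ x hx).differentiableAt, h₃.differentiableAt, ?_⟩
  rw [h₃.deriv, (h₂ x hx).deriv, h₁.deriv]
  simp only [Pi.mul_apply]
  generalize 2 * Real.arcsin x / √(1 - x ^ 2) = g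
  field_simp
  ring
end

section
/- For every real number x with 0 ≤ x ≤ 1, the series ∑_{k=0}^∞ (2k)! · x^k / (4^k · (k!)² · (2k-1)²) converges and its sum equals √x · arcsin(√x) + √(1-x); i.e., √x·arcsin(√x) + √(1-x) = ₂F₁(-1/2, -1/2; 1/2; x). -/
open Nat

/-- Termwise differentiation of a lacunary power series with coefficients bounded by one. -/
theorem hasDerivAt_tsum_div_mul_pow_succ {b : ℕ → ℝ} {e : ℕ → ℕ} (hb : ∀ k, |b k| ≤ 1)
    (he : ∀ k, k ≤ e k) {t : ℝ} (ht : t ∈ Set.Ioo (-1 : ℝ) 1) :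
    HasDerivAt (fun z : ℝ => ∑' k, b k / (e k + 1) * z ^ (e k + 1)) (∑' k, b k * t ^ e k) t := by
  obtain ⟨r, hr, hr1⟩ := exists_between (abs_lt.2 ht)
  have hr0 : 0 ≤ r := (abs_nonneg t).trans hr.le
  refine hasDerivAt_tsum_of_isPreconnected (𝕜 := ℝ) (F := ℝ)
    (g := fun k z => b k / (e k + 1) * z ^ (e k + 1)) (g' := fun k z => b k * z ^ e k)
    (t := Set.Ioo (-r) r) (y₀ := 0)
    (summable_geometric_of_lt_one hr0 hr1) isOpen_Ioo isPreconnected_Ioo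
    (fun k y _ => ?_) (fun k y hy => ?_) ?_ ?_ (abs_lt.1 hr)
  · have h := (hasDerivAt_pow (e k + 1) y).const_mul (b k / (e k + 1))
    convert! h using 1
    push_cast
    field_simp
  · have hy' : |y| ≤ r := (abs_lt.2 hy).le
    rw [Real.norm_eq_abs, abs_mul, abs_pow]
    calc |b k| * |y| ^ e k ≤ 1 * r ^ e k := by gcongr; exact hb k
      _ ≤ r ^ k := by rw [one_mul]; exact pow_le_pow_of_le_one hr0 hr1.le (he k)
  · have : 0 < r := (abs_nonneg t).trans_lt hr
    simpa using this
  · simp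

/-- A function vanishing at zero whose derivative is a power series is the termwise
antiderivative of that series. -/
theorem eqOn_tsum_div_mul_pow_succ {b : ℕ → ℝ} {e : ℕ → ℕ} (hb : ∀ k, |b k| ≤ 1)
    (he : ∀ k, k ≤ e k) {f : ℝ → ℝ} (hf0 : f 0 = 0)
    (hf : ∀ t ∈ Set.Ioo (-1 : ℝ) 1, HasDerivAt f (∑' k, b k * t ^ e k) t) :
    Set.EqOn f (fun z => ∑' k, b k / (e k + 1) * z ^ (e k + 1)) (Set.Ioo (-1) 1) := by
  have hg := fun t ht => hasDerivAt_tsum_div_mul_pow_succ hb he (t := t) ht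
  refine isOpen_Ioo.eqOn_of_deriv_eq (x := 0) isPreconnected_Ioo
    (fun t ht => (hf t ht).differentiableAt.differentiableWithinAt)
    (fun t ht => (hg t ht).differentiableAt.differentiableWithinAt)
    (fun t ht => (hf t ht).deriv.trans (hg t ht).deriv.symm) (by simp) (by simp [hf0])

theorem Ring.choose_half_add_sub_one (n : ℕ) :
    Ring.choose ((1 / 2 : ℝ) + n - 1) n = (centralBinom n : ℝ) / 4 ^ n := by
  rw [← Ring.multichoose_eq]
  have key : ∀ n : ℕ, ((ascPochhammer ℕ n).smeval (1 / 2 : ℝ)) =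
      (n ! : ℝ) * ((centralBinom n : ℝ) / 4 ^ n) := by
    intro n
    induction n with
    | zero => simp
    | succ n ih =>
      have h : ((n : ℝ) + 1) * centralBinom (n + 1) = 2 * (2 * n + 1) * centralBinom n := by
        exact_mod_cast succ_mul_centralBinom_succ n
      rw [ascPochhammer_succ_right, Polynomial.smeval_mul, ih, Nat.factorial_succ,
        Polynomial.smeval_add, Polynomial.smeval_X, Polynomial.smeval_natCast]
      push_cast
      field_simp
      simp only [pow_succ, nsmul_eq_mul]
      linear_combination (-2 * 4 ^ n : ℝ) * h
  have h := Ring.factorial_nsmul_multichoose_eq_ascPochhammer (1 / 2 : ℝ) n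
  rw [key, nsmul_eq_mul] at h
  exact mul_left_cancel₀ (by positivity) h

theorem hasSum_centralBinom_div_mul_pow {x : ℝ} (hx : |x| < 1) :
    HasSum (fun k => (centralBinom k : ℝ) / 4 ^ k * x ^ k) (1 / √(1 - x)) := by
  have h := (Real.one_div_one_sub_rpow_hasFPowerSeriesOnBall_zero (1 / 2)).hasSum (y := x)
    (by simpa [enorm_eq_nnnorm, ← NNReal.coe_lt_coe] using hx)
  simp only [Ring.choose_half_add_sub_one] at h
  simpa [Real.sqrt_eq_rpow, mul_comm] using h

theorem abs_centralBinom_div_le_one (k : ℕ) : |(centralBinom k : ℝ) / 4 ^ k| ≤ 1 := by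
  rw [abs_of_nonneg (by positivity), div_le_one (by positivity)]
  exact_mod_cast centralBinom_le_four_pow k

theorem arcsin_eq_tsum {t : ℝ} (ht : t ∈ Set.Ioo (-1 : ℝ) 1) :
    Real.arcsin t =
      ∑' k : ℕ, (centralBinom k : ℝ) / 4 ^ k / (2 * k + 1) * t ^ (2 * k + 1) := by
  have h := eqOn_tsum_div_mul_pow_succ (e := fun k => 2 * k) (f := Real.arcsin)
    abs_centralBinom_div_le_one (fun k => by lia) Real.arcsin_zero (fun t ht => ?_) ht
  · simpa using h
  · have hs : |t ^ 2| < 1 := by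
      rw [abs_pow]
      exact pow_lt_one₀ (abs_nonneg t) (abs_lt.2 ht) two_ne_zero
    simp only [pow_mul]
    rw [(hasSum_centralBinom_div_mul_pow hs).tsum_eq]
    exact Real.hasDerivAt_arcsin ht.1.ne' ht.2.ne

theorem abs_centralBinom_div_div_le_one (k : ℕ) :
    |(centralBinom k : ℝ) / 4 ^ k / (2 * k + 1)| ≤ 1 := by
  rw [abs_div, abs_of_pos (by positivity : (0 : ℝ) < 2 * k + 1)]
  exact (_root_.div_le_self (abs_nonneg _) (by linarith [k.cast_nonneg (α := ℝ)])).trans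
    (abs_centralBinom_div_le_one k)

theorem norm_mul_arcsin_series_term_le (k : ℕ) {t : ℝ} (ht : t ∈ Set.Icc (-1 : ℝ) 1) :
    ‖(centralBinom k : ℝ) / 4 ^ k / (2 * k + 1) / ((2 * k + 1 : ℕ) + 1) * t ^ (2 * k + 1 + 1)‖ ≤
      1 / ((k + 1 : ℕ) : ℝ) ^ 2 := by
  have hk : (0 : ℝ) ≤ k := k.cast_nonneg
  rw [norm_mul, norm_pow, Real.norm_eq_abs, Real.norm_eq_abs]
  calc _ ≤ |(centralBinom k : ℝ) / 4 ^ k / (2 * k + 1) / ((2 * k + 1 : ℕ) + 1)| * 1 := by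
        gcongr
        exact pow_le_one₀ (abs_nonneg t) (abs_le.2 ht)
    _ = |(centralBinom k : ℝ) / 4 ^ k| / ((2 * k + 1) * (2 * k + 2)) := by
        rw [mul_one, div_div, abs_div, abs_of_pos (by positivity :
          (0 : ℝ) < (2 * k + 1) * ((2 * k + 1 : ℕ) + 1))]
        push_cast
        ring
    _ ≤ 1 / ((k + 1 : ℕ) : ℝ) ^ 2 := by
        gcongr
        · exact abs_centralBinom_div_le_one k
        · push_cast
          nlinarith

theorem hasDerivAt_mul_arcsin_add_sqrt {t : ℝ} (ht : t ∈ Set.Ioo (-1 : ℝ) 1) :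
    HasDerivAt (fun t => t * Real.arcsin t + √(1 - t ^ 2) - 1) (Real.arcsin t) t := by
  have hpos : 0 < 1 - t ^ 2 := by nlinarith [ht.1, ht.2]
  have h := (((hasDerivAt_id t).mul (Real.hasDerivAt_arcsin ht.1.ne' ht.2.ne)).add
    (((hasDerivAt_pow 2 t).const_sub 1).sqrt hpos.ne')).sub_const 1
  convert! h using 1
  have := Real.sqrt_pos.2 hpos
  simp only [id]
  field_simp
  ring

theorem hasSum_mul_arcsin_add_sqrt {t : ℝ} (ht : t ∈ Set.Icc (-1 : ℝ) 1) :
    HasSum (fun k : ℕ => (centralBinom k : ℝ) / 4 ^ k / (2 * k + 1) / ((2 * k + 1 : ℕ) + 1) *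
      t ^ (2 * k + 1 + 1)) (t * Real.arcsin t + √(1 - t ^ 2) - 1) := by
  have hu : Summable fun k : ℕ => 1 / ((k + 1 : ℕ) : ℝ) ^ 2 :=
    (summable_nat_add_iff 1).2 (Real.summable_one_div_nat_pow.2 one_lt_two)
  have hsum := Summable.of_norm_bounded hu fun k => norm_mul_arcsin_series_term_le k ht
  have hopen := eqOn_tsum_div_mul_pow_succ (e := fun k => 2 * k + 1)
    (f := fun t => t * Real.arcsin t + √(1 - t ^ 2) - 1)
    abs_centralBinom_div_div_le_one (fun k => by lia) (by simp)
    (fun t ht => arcsin_eq_tsum ht ▸ hasDerivAt_mul_arcsin_add_sqrt ht)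
  have hclosed := hopen.of_subset_closure (t := Set.Icc (-1) 1)
    (by fun_prop)
    (continuousOn_tsum (fun k => by fun_prop) hu fun k t ht => norm_mul_arcsin_series_term_le k ht)
    Set.Ioo_subset_Icc_self (by rw [closure_Ioo (by norm_num)])
  have := hclosed ht
  dsimp only at this
  rw [this]
  exact hsum.hasSum

/-- For `0 ≤ x ≤ 1`,
`∑_{k=0}^∞ (2k)!·x^k / (4^k·(k!)²·(2k-1)²) = √x·arcsin(√x) + √(1-x)`,
i.e. `√x·arcsin(√x) + √(1-x) = ₂F₁(-1/2, -1/2; 1/2; x)`. -/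
theorem sqrt_arcsin_sqrt_series (x : ℝ) (hx0 : 0 ≤ x) (hx1 : x ≤ 1) :
    HasSum (fun k : ℕ =>
      ((2 * k)! : ℝ) * x ^ k / (4 ^ k * ((k ! : ℝ)) ^ 2 * (2 * (k : ℝ) - 1) ^ 2))
      (Real.sqrt x * Real.arcsin (Real.sqrt x) + Real.sqrt (1 - x)) := by
  have ht : √x ∈ Set.Icc (-1 : ℝ) 1 :=
    ⟨by linarith [Real.sqrt_nonneg x], Real.sqrt_le_one.2 hx1⟩
  have h := hasSum_mul_arcsin_add_sqrt ht
  rw [Real.sq_sqrt hx0] at h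
  rw [← hasSum_nat_add_iff' 1]
  simp only [Finset.sum_range_one]
  convert! h using 1
  · funext k
    have hc : ((2 * (k + 1))! : ℝ) = centralBinom (k + 1) * ((k + 1)! : ℝ) ^ 2 := by
      have := Nat.choose_mul_factorial_mul_factorial (show k + 1 ≤ 2 * (k + 1) by lia)
      rw [show 2 * (k + 1) - (k + 1) = k + 1 by lia, ← centralBinom_eq_two_mul_choose] at this
      rw [← this]
      push_cast
      ring
    have hs : ((k : ℝ) + 1) * centralBinom (k + 1) = 2 * (2 * k + 1) * centralBinom k := by
      exact_mod_cast succ_mul_centralBinom_succ k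
    have hp : √x ^ (2 * k + 1 + 1) = x ^ (k + 1) := by
      rw [show 2 * k + 1 + 1 = 2 * (k + 1) by ring, pow_mul, Real.sq_sqrt hx0]
    have hd : 2 * ((k : ℝ) + 1) - 1 = 2 * k + 1 := by ring
    rw [hp, hc]
    push_cast
    rw [hd, eq_div_of_mul_eq (by positivity) ((mul_comm _ _).trans hs), pow_succ (4 : ℝ)]
    field_simp
    ring
  · simp
end

section
/- Let H_n = ∑_{k=1}^{n} 1/k denote the n-th harmonic number (a rational number). Then there do not exist polynomials p, q with rational coefficients, both nonzero, such that q(n) · H_{n+1} = p(n) · H_n for all natural numbers n ≥ 1. In other words, the harmonic numbers do not form a hypergeometric term: the ratio H_{n+1}/H_n is not a rational function of n. -/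
/-- The `n`-th harmonic number `H_n = ∑_{k=1}^{n} 1/k` as a rational number. -/
def harmonicNumber (n : ℕ) : ℚ :=
  ∑ k ∈ Finset.Icc 1 n, (1 : ℚ) / k

open Filter Asymptotics Polynomial

theorem harmonicNumber_eq_harmonic (n : ℕ) : harmonicNumber n = harmonic n := by
  simp [harmonicNumber, harmonic_eq_sum_Icc]

theorem tendsto_harmonic_atTop :
    Tendsto (fun n : ℕ => (harmonic n : ℝ)) atTop atTop := by
  refine tendsto_atTop_mono (fun n => log_add_one_le_harmonic n) ?_
  exact Real.tendsto_log_atTop.comp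
    (tendsto_natCast_atTop_atTop.comp (tendsto_add_atTop_nat 1))

theorem harmonic_isLittleO_natCast :
    (fun n : ℕ => (harmonic n : ℝ)) =o[atTop] fun n : ℕ => (n : ℝ) := by
  have h_log : (fun n : ℕ => 1 + Real.log n) =o[atTop] fun n : ℕ => (n : ℝ) :=
    ((isLittleO_const_id_atTop (1 : ℝ)).add Real.isLittleO_log_id_atTop).comp_tendsto
      tendsto_natCast_atTop_atTop
  refine (IsBigO.of_bound' (Eventually.of_forall fun n => ?_)).trans_isLittleO h_log
  have h_nonneg : (0 : ℝ) ≤ harmonic n :=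
    (Real.log_nonneg (by simp)).trans (log_add_one_le_harmonic n)
  rw [Real.norm_of_nonneg h_nonneg]
  exact (harmonic_le_one_add_log n).trans (le_abs_self _)

theorem Polynomial.eventually_eval_natCast_ne_zero {r : ℝ[X]} (hr : r ≠ 0) :
    ∀ᶠ n : ℕ in atTop, r.eval (n : ℝ) ≠ 0 :=
  tendsto_natCast_atTop_atTop.eventually (r.eventually_atTop_not_isRoot hr)

/-- A sequence tending to infinity more slowly than `n` is not a quotient of polynomials. -/
theorem Polynomial.eq_zero_of_eval_mul_eq_eval {f : ℕ → ℝ} (hf : Tendsto f atTop atTop)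
    (hfo : f =o[atTop] fun n : ℕ => (n : ℝ)) {r q : ℝ[X]}
    (h : ∀ᶠ n : ℕ in atTop, r.eval (n : ℝ) * f n = q.eval (n : ℝ)) : r = 0 := by
  by_contra hr
  have hr' := eventually_eval_natCast_ne_zero hr
  rcases le_or_gt q.degree r.degree with hd | hd
  · have hO : (fun n : ℕ => q.eval (n : ℝ)) =O[atTop] fun n : ℕ => r.eval (n : ℝ) :=
      (isBigO_atTop_of_degree_le q r hd).comp_tendsto tendsto_natCast_atTop_atTop
    obtain ⟨C, hC⟩ := hO.bound
    obtain ⟨n, hn, hn0, hnq, hfn⟩ :=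
      (hC.and (hr'.and (h.and (hf.eventually_gt_atTop C)))).exists
    rw [← hnq, norm_mul, mul_comm] at hn
    have := le_of_mul_le_mul_right hn (norm_pos_iff.2 hn0)
    exact absurd ((le_abs_self (f n)).trans this) (not_le.2 hfn)
  · have hdeg : (X * r).degree ≤ q.degree := by
      have hnat := natDegree_lt_natDegree hr hd
      rw [degree_eq_natDegree (mul_ne_zero X_ne_zero hr),
        degree_eq_natDegree (ne_zero_of_degree_gt hd), natDegree_X_mul hr]
      exact_mod_cast hnat
    have hO : (fun n : ℕ => (X * r).eval (n : ℝ)) =O[atTop] fun n : ℕ => q.eval (n : ℝ) :=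
      (isBigO_atTop_of_degree_le _ _ hdeg).comp_tendsto tendsto_natCast_atTop_atTop
    have hXO : (fun n : ℕ => (n : ℝ)) =O[atTop] f := by
      obtain ⟨C, hC⟩ := hO.bound
      refine IsBigO.of_bound C ?_
      filter_upwards [hC, hr', h] with n hn hn0 hnq
      rw [← hnq, eval_mul, eval_X, norm_mul, norm_mul, mul_comm ‖eval (n : ℝ) r‖,
        ← mul_assoc] at hn
      exact le_of_mul_le_mul_right hn (norm_pos_iff.2 hn0)
    obtain ⟨n, hn, hn0⟩ :=
      (((hXO.trans_isLittleO hfo).bound (c := 1 / 2) (by norm_num)).and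
        (eventually_gt_atTop 0)).exists
    have : (0 : ℝ) < n := Nat.cast_pos.2 hn0
    rw [Real.norm_of_nonneg this.le] at hn
    linarith

/-- The harmonic numbers do not form a hypergeometric term: there are no nonzero
rational polynomials `p, q` with `q(n)·H_{n+1} = p(n)·H_n` for all `n ≥ 1`. -/
theorem harmonic_not_hypergeometric :
    ¬ ∃ p q : Polynomial ℚ, p ≠ 0 ∧ q ≠ 0 ∧
      ∀ n : ℕ, 1 ≤ n →
        q.eval (n : ℚ) * harmonicNumber (n + 1) = p.eval (n : ℚ) * harmonicNumber n := by
  rintro ⟨p, q, -, hq, h⟩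
  have key : ∀ n : ℕ, 1 ≤ n → ((X + 1) * (p - q)).eval (n : ℚ) * harmonic n = q.eval (n : ℚ) := by
    intro n hn
    have hrec := h n hn
    simp only [harmonicNumber_eq_harmonic, harmonic_succ] at hrec
    have hn0 : ((n : ℚ) + 1) ≠ 0 := by positivity
    push_cast at hrec
    field_simp at hrec
    simp only [eval_mul, eval_add, eval_sub, eval_X, eval_one]
    linarith
  let φ := algebraMap ℚ ℝ
  have keyR : ∀ᶠ n : ℕ in atTop,
      (((X + 1) * (p - q)).map φ).eval (n : ℝ) * (harmonic n : ℝ) = (q.map φ).eval (n : ℝ) := by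
    filter_upwards [eventually_ge_atTop 1] with n hn
    have := congrArg φ (key n hn)
    rwa [map_mul, ← eval_map_apply, ← eval_map_apply, map_natCast] at this
  have hr := eq_zero_of_eval_mul_eq_eval tendsto_harmonic_atTop harmonic_isLittleO_natCast keyR
  have hqR : q.map φ ≠ 0 := (Polynomial.map_ne_zero_iff φ.injective).2 hq
  obtain ⟨n, hn, hnq⟩ := (keyR.and (eventually_eval_natCast_ne_zero hqR)).exists
  rw [hr, eval_zero, zero_mul] at hn
  exact hnq hn.symm
end
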